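/- arXiv:2205.11970 — 2 statements merged into one kernel-verified Lean document; each statement's English description precedes it below -/
import Mathlib

section
/- Let d ≥ 1 be an integer and m, b, M, β > 0, and let F, G ∈ C¹(ℝ^d;ℝ) be nonnegative, (m,b)-dissipative and M-smooth. Then there exists a constant C₀ > 0 depending only on (m, b, M, β, ‖∇F(0)‖, ‖∇G(0)‖, d) such that W_{ρ₂}(π_{β,F}, π_{β,G}) ≤ C₀ (∫_{ℝ^d} ‖∇F(x) − ∇G(x)‖² π_{β,G}(dx))^{1/2}, where the construction of ρ₂ is carried out with these m, b, M, β, d. -/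
open MeasureTheory Real RealInnerProductSpace

noncomputable section

def Vbar {d : ℕ} (x : EuclideanSpace ℝ (Fin d)) : ℝ := 1 + ‖x‖ ^ 2

def Cc (d : ℕ) (m b β : ℝ) : ℝ := 2 * ((d : ℝ) / β + b) + m

def S1 (d : ℕ) (m b β : ℝ) : Set (EuclideanSpace ℝ (Fin d) × EuclideanSpace ℝ (Fin d)) :=
  {p | Vbar p.1 + Vbar p.2 ≤ 2 * Cc d m b β / m}

def S2 (d : ℕ) (m b β : ℝ) : Set (EuclideanSpace ℝ (Fin d) × EuclideanSpace ℝ (Fin d)) :=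
  {p | Vbar p.1 + Vbar p.2 ≤ 4 * Cc d m b β * (1 + 1 / m)}

def R1 (d : ℕ) (m b β : ℝ) : ℝ := Metric.diam (S1 d m b β)

def R2 (d : ℕ) (m b β : ℝ) : ℝ := Metric.diam (S2 d m b β)

def kappa (d : ℕ) (m b M β : ℝ) : ℝ :=
  min (1 / 2)
    (2 / (Cc d m b β * β * (Real.exp (2 * R1 d m b β) - 1 - 2 * R1 d m b β)) *
      Real.exp (-(M * β * R1 d m b β ^ 2 / 8)))

def Qk (d : ℕ) (m b M β : ℝ) : ℝ :=
  2 * Real.sqrt (kappa d m b M β - kappa d m b M β ^ 2)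

def phi (d : ℕ) (m b M β : ℝ) (r : ℝ) : ℝ :=
  Real.exp (-(M * β / 8) * r ^ 2 - 2 * Qk d m b M β * r)

def Phi (d : ℕ) (m b M β : ℝ) (r : ℝ) : ℝ :=
  ∫ s in (0:ℝ)..r, phi d m b M β s

def zeta (d : ℕ) (m b M β : ℝ) : ℝ :=
  (∫ s in (0:ℝ)..(R2 d m b β), Phi d m b M β s * (phi d m b M β s)⁻¹)⁻¹

def xi (d : ℕ) (m b M β : ℝ) : ℝ :=
  (∫ s in (0:ℝ)..(R1 d m b β), Phi d m b M β s * (phi d m b M β s)⁻¹)⁻¹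

def gfun (d : ℕ) (m b M β : ℝ) (r : ℝ) : ℝ :=
  1 - zeta d m b M β / 4 *
      (∫ s in (0:ℝ)..(min r (R2 d m b β)), Phi d m b M β s * (phi d m b M β s)⁻¹)
    - xi d m b M β / 4 *
      (∫ s in (0:ℝ)..(min r (R1 d m b β)), Phi d m b M β s * (phi d m b M β s)⁻¹)

def ffun (d : ℕ) (m b M β : ℝ) (r : ℝ) : ℝ :=
  if r < 0 then r else ∫ s in (0:ℝ)..(min r (R2 d m b β)), phi d m b M β s * gfun d m b M β s

def Ufun (d : ℕ) (m b M β : ℝ) (x y : EuclideanSpace ℝ (Fin d)) : ℝ :=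
  1 + kappa d m b M β * Vbar x + kappa d m b M β * Vbar y

def rho2 (d : ℕ) (m b M β : ℝ) (x y : EuclideanSpace ℝ (Fin d)) : ℝ :=
  ffun d m b M β ‖x - y‖ * Ufun d m b M β x y

def Wrho2 (d : ℕ) (m b M β : ℝ) (μ ν : Measure (EuclideanSpace ℝ (Fin d))) : ℝ :=
  ⨅ γ : {γ : Measure (EuclideanSpace ℝ (Fin d) × EuclideanSpace ℝ (Fin d)) //
      IsProbabilityMeasure γ ∧ γ.map Prod.fst = μ ∧ γ.map Prod.snd = ν},
    ∫ p, rho2 d m b M β p.1 p.2 ∂γ.1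

def gibbs (d : ℕ) (β : ℝ) (F : EuclideanSpace ℝ (Fin d) → ℝ) :
    Measure (EuclideanSpace ℝ (Fin d)) :=
  volume.withDensity fun x => ENNReal.ofReal (Real.exp (-β * F x) / ∫ y, Real.exp (-β * F y))

def Dissipative (d : ℕ) (m b : ℝ) (F : EuclideanSpace ℝ (Fin d) → ℝ) : Prop :=
  ∀ x, m * ‖x‖ ^ 2 - b ≤ ⟪gradient F x, x⟫

def LSmooth (d : ℕ) (M : ℝ) (F : EuclideanSpace ℝ (Fin d) → ℝ) : Prop :=
  ∀ x y, ‖gradient F x - gradient F y‖ ≤ M * ‖x - y‖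

/-- Change of variables under contraction by a factor `t ≥ 1/2`. -/
lemma lintegral_smul_add_le {d : ℕ} {w : EuclideanSpace ℝ (Fin d) → ENNReal} (hw : Measurable w)
    {t : ℝ} (ht : 1 / 2 ≤ t) (z : EuclideanSpace ℝ (Fin d)) :
    ∫⁻ x, w (t • x + z) ≤ 2 ^ d * ∫⁻ x, w x := by
  have ht0 : 0 < t := by linarith
  have h1 : ∫⁻ x, w (t • x + z) = ∫⁻ v, w (v + z) ∂(Measure.map (fun x => t • x)
      (volume : Measure (EuclideanSpace ℝ (Fin d)))) := by
    rw [lintegral_map (by fun_prop) (by fun_prop)]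
  rw [h1, Measure.map_addHaar_smul _ ht0.ne', lintegral_smul_measure,
    lintegral_add_right_eq_self]
  simp only [finrank_euclideanSpace, Fintype.card_fin, smul_eq_mul]
  gcongr
  rw [abs_of_pos (by positivity)]
  calc ENNReal.ofReal ((t ^ d)⁻¹) ≤ ENNReal.ofReal (2 ^ d) := by
        apply ENNReal.ofReal_le_ofReal
        rw [inv_le_comm₀ (by positivity) (by positivity), ← inv_pow]
        gcongr
        linarith
    _ = 2 ^ d := by
        rw [ENNReal.ofReal_pow (by norm_num)]; simp

/-- Averaging a nonnegative function over the points dividing the segments with both endpoints in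
a set in the fixed ratio `t : 1 - t`. -/
lemma lintegral_prod_segment_le {d : ℕ} {w : EuclideanSpace ℝ (Fin d) → ENNReal}
    (hw : Measurable w) (B : Set (EuclideanSpace ℝ (Fin d))) {t : ℝ} :
    ∫⁻ p, w (t • p.1 + (1 - t) • p.2) ∂((volume.restrict B).prod (volume.restrict B)) ≤
      2 ^ d * (∫⁻ x, w x) * volume B := by
  have key : ∀ s : ℝ, 1 / 2 ≤ s →
      ∫⁻ y, ∫⁻ x, w (s • x + (1 - s) • y) ∂(volume.restrict B) ∂(volume.restrict B) ≤
        2 ^ d * (∫⁻ x, w x) * volume B := by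
    intro s hs
    calc _ ≤ ∫⁻ y, 2 ^ d * (∫⁻ x, w x) ∂(volume.restrict B) := by
          refine lintegral_mono fun y => ?_
          exact (lintegral_mono' Measure.restrict_le_self le_rfl).trans
            (lintegral_smul_add_le hw hs _)
      _ = _ := by simp
  rcases le_total (1 / 2) t with h | h
  · rw [lintegral_prod_symm _ (by fun_prop)]
    exact key t h
  · rw [lintegral_prod _ (by fun_prop)]
    convert key (1 - t) (by linarith) using 6
    rw [add_comm]; simp

/-- A Poincaré inequality in `L¹` on balls. -/
lemma exists_lintegral_closedBall_sub_le {d : ℕ} {h : EuclideanSpace ℝ (Fin d) → ℝ}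
    (hh : ContDiff ℝ 1 h) {R : ℝ} (hR : 0 < R) :
    ∃ c : ℝ, ∫⁻ x in Metric.closedBall 0 R, ‖h x - c‖ₑ ≤
      ENNReal.ofReal (2 * R) * 2 ^ d * ∫⁻ x in Metric.closedBall 0 R, ‖fderiv ℝ h x‖ₑ := by
  set B : Set (EuclideanSpace ℝ (Fin d)) := Metric.closedBall 0 R with hB
  have hBm : MeasurableSet B := measurableSet_closedBall
  have hB0 : volume B ≠ 0 := (Metric.measure_closedBall_pos _ _ hR).ne'
  have hBt : volume B ≠ ⊤ := measure_closedBall_lt_top.ne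
  set w : EuclideanSpace ℝ (Fin d) → ENNReal := B.indicator fun x => ‖fderiv ℝ h x‖ₑ with hwdef
  have hcont : Continuous (fderiv ℝ h) := hh.continuous_fderiv one_ne_zero
  have hw : Measurable w := (hcont.enorm.measurable).indicator hBm
  have hconv : Convex ℝ B := convex_closedBall _ _
  have hseg : ∀ x ∈ B, ∀ y ∈ B, ‖h x - h y‖ₑ ≤
      ∫⁻ t in Set.Icc (0:ℝ) 1, ENNReal.ofReal (2 * R) * w (t • x + (1 - t) • y) := by
    intro x hx y hy
    have hd : ∀ t : ℝ, HasDerivAt (fun t : ℝ => h (t • x + (1 - t) • y))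
        (fderiv ℝ h (t • x + (1 - t) • y) (x - y)) t := by
      intro t
      have h1 : HasDerivAt (fun t : ℝ => t • x + (1 - t) • y) (x - y) t := by
        have := ((hasDerivAt_id t).smul_const x).add
          (((hasDerivAt_const t (1:ℝ)).sub (hasDerivAt_id t)).smul_const y)
        convert! this using 1
        simp [sub_eq_add_neg]
      exact ((hh.differentiable one_ne_zero _).hasFDerivAt).comp_hasDerivAt t h1
    have hci : Continuous fun t : ℝ => fderiv ℝ h (t • x + (1 - t) • y) (x - y) := by fun_prop
    have hftc := intervalIntegral.integral_eq_sub_of_hasDerivAt (a := 0) (b := 1)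
      (fun t _ => hd t) (hci.intervalIntegrable _ _)
    simp only [one_smul, sub_self, zero_smul, add_zero, zero_add, sub_zero] at hftc
    rw [← hftc, intervalIntegral.integral_of_le zero_le_one, ← integral_Icc_eq_integral_Ioc]
    refine (enorm_integral_le_lintegral_enorm _).trans ?_
    refine setLIntegral_mono' measurableSet_Icc fun t ht => ?_
    have hmem : t • x + (1 - t) • y ∈ B :=
      hconv hx hy ht.1 (by linarith [ht.2]) (by ring)
    rw [hwdef, Set.indicator_of_mem hmem]
    refine (ContinuousLinearMap.le_opENorm _ _).trans ?_
    rw [mul_comm]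
    gcongr
    rw [← ofReal_norm]
    apply ENNReal.ofReal_le_ofReal
    have h1 : ‖x‖ ≤ R := by simpa [hB] using hx
    have h2 : ‖y‖ ≤ R := by simpa [hB] using hy
    linarith [norm_sub_le x y]
  have hdouble : ∫⁻ y in B, ∫⁻ x in B, ‖h x - h y‖ₑ ≤
      ENNReal.ofReal (2 * R) * (2 ^ d * (∫⁻ x, w x) * volume B) := by
    have hmeas : Measurable fun p : (EuclideanSpace ℝ (Fin d) × EuclideanSpace ℝ (Fin d)) =>
      ‖h p.1 - h p.2‖ₑ := by
      have := hh.continuous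
      exact (by fun_prop : Continuous fun
        p : (EuclideanSpace ℝ (Fin d) × EuclideanSpace ℝ (Fin d)) =>
          ‖h p.1 - h p.2‖ₑ).measurable
    calc _ = ∫⁻ y in B, ∫⁻ x in B, ‖h x - h y‖ₑ := rfl
      _ ≤ ∫⁻ y in B, ∫⁻ x in B, ∫⁻ t in Set.Icc (0:ℝ) 1,
            ENNReal.ofReal (2 * R) * w (t • x + (1 - t) • y) :=
          setLIntegral_mono' hBm fun y hy => setLIntegral_mono' hBm fun x hx => hseg x hx y hy
      _ = ∫⁻ p, (∫⁻ t in Set.Icc (0:ℝ) 1,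
            ENNReal.ofReal (2 * R) * w (t • p.1 + (1 - t) • p.2))
            ∂((volume.restrict B).prod (volume.restrict B)) := by
          rw [lintegral_prod_symm]
          refine (Measurable.lintegral_prod_right' (f := fun q :
            (EuclideanSpace ℝ (Fin d) × EuclideanSpace ℝ (Fin d)) × ℝ =>
            ENNReal.ofReal (2 * R) * w (q.2 • q.1.1 + (1 - q.2) • q.1.2)) ?_).aemeasurable
          fun_prop
      _ = ∫⁻ t in Set.Icc (0:ℝ) 1, ∫⁻ p,
            ENNReal.ofReal (2 * R) * w (t • p.1 + (1 - t) • p.2)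
            ∂((volume.restrict B).prod (volume.restrict B)) := by
          rw [lintegral_lintegral_swap]
          fun_prop
      _ ≤ ∫⁻ t in Set.Icc (0:ℝ) 1,
            ENNReal.ofReal (2 * R) * (2 ^ d * (∫⁻ x, w x) * volume B) := by
          refine lintegral_mono fun t => ?_
          rw [lintegral_const_mul _ (by fun_prop)]
          gcongr
          exact lintegral_prod_segment_le hw B
      _ = _ := by simp
  have hae : AEMeasurable (fun y => ∫⁻ x in B, ‖h x - h y‖ₑ) (volume.restrict B) := by
    have := hh.continuous
    refine (Measurable.lintegral_prod_left' (f := fun p :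
      (EuclideanSpace ℝ (Fin d) × EuclideanSpace ℝ (Fin d)) => ‖h p.1 - h p.2‖ₑ) ?_).aemeasurable
    exact Continuous.measurable (by fun_prop)
  obtain ⟨y, -, hy⟩ := exists_le_setLAverage hB0 hBt hae
  refine ⟨h y, hy.trans ?_⟩
  rw [setLAverage_eq]
  refine ENNReal.div_le_of_le_mul (hdouble.trans (le_of_eq ?_))
  rw [hwdef, lintegral_indicator hBm]
  ring

/-- Integration by parts against the Euler vector field. -/
lemma integral_fderiv_apply_self {d : ℕ} {w : EuclideanSpace ℝ (Fin d) → ℝ}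
    (hw : ContDiff ℝ 1 w) (h0 : Integrable w) (h1 : Integrable fun x => ‖x‖ * w x)
    (h2 : Integrable fun x => ‖x‖ * ‖fderiv ℝ w x‖) :
    ∫ x, fderiv ℝ w x x = -(d * ∫ x, w x) := by
  have hc : Continuous (fderiv ℝ w) := hw.continuous_fderiv one_ne_zero
  have hwc := hw.continuous
  have hcoord : ∀ i (x : EuclideanSpace ℝ (Fin d)), |x i| ≤ ‖x‖ := fun i x =>
    PiLp.norm_apply_le x i
  have hpart : ∀ i, Integrable fun x : EuclideanSpace ℝ (Fin d) =>
      x i * fderiv ℝ w x (EuclideanSpace.single i 1) := by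
    intro i
    refine h2.mono' (Continuous.aestronglyMeasurable (by fun_prop)) (.of_forall fun x => ?_)
    rw [norm_mul]
    refine mul_le_mul (hcoord i x) ?_ (norm_nonneg _) (norm_nonneg _)
    simpa using (fderiv ℝ w x).le_opNorm (EuclideanSpace.single i 1)
  have hone : ∀ i, ∫ x : EuclideanSpace ℝ (Fin d),
      x i * fderiv ℝ w x (EuclideanSpace.single i 1) = -∫ x, w x := by
    intro i
    have hfd : ∀ x : EuclideanSpace ℝ (Fin d), HasFDerivAt (fun x : EuclideanSpace ℝ (Fin d) => x i)
        (EuclideanSpace.proj i : EuclideanSpace ℝ (Fin d) →L[ℝ] ℝ) x := fun x =>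
      (EuclideanSpace.proj i : EuclideanSpace ℝ (Fin d) →L[ℝ] ℝ).hasFDerivAt
    have hfd1 : ∀ x : EuclideanSpace ℝ (Fin d), fderiv ℝ (fun x : EuclideanSpace ℝ (Fin d) => x i) x
        (EuclideanSpace.single i 1) = 1 := by
      intro x
      rw [(hfd x).fderiv]
      simp
    have := integral_mul_fderiv_eq_neg_fderiv_mul_of_integrable (μ := volume)
      (f := fun x : EuclideanSpace ℝ (Fin d) => x i) (g := w) (v := EuclideanSpace.single i 1)
      (by simpa only [hfd1, one_mul] using h0) (hpart i)
      (by
        refine h1.mono (Continuous.aestronglyMeasurable (by fun_prop)) (.of_forall fun x => ?_)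
        rw [norm_mul, norm_mul, norm_norm]
        exact mul_le_mul_of_nonneg_right (hcoord i x) (norm_nonneg _))
      (fun x _ => (hfd x).differentiableAt) (fun x _ => hw.differentiable one_ne_zero x)
    simpa only [hfd1, one_mul] using this
  have hsum : ∀ x : EuclideanSpace ℝ (Fin d), fderiv ℝ w x x =
      ∑ i, x i * fderiv ℝ w x (EuclideanSpace.single i 1) := by
    intro x
    have hx : x = ∑ i, x i • EuclideanSpace.single i (1:ℝ) := by
      ext j
      simp [Finset.sum_apply, Pi.single_apply]
    conv_lhs => rw [hx, map_sum]
    rw [← hx]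
    simp
  simp_rw [hsum]
  rw [integral_finsetSum _ fun i _ => hpart i]
  simp [hone]

lemma fderiv_eq_inner_gradient {d : ℕ} (F : EuclideanSpace ℝ (Fin d) → ℝ)
    (x v : EuclideanSpace ℝ (Fin d)) : fderiv ℝ F x v = ⟪gradient F x, v⟫ := by
  simp [gradient]

lemma norm_fderiv_eq_norm_gradient {d : ℕ} (F : EuclideanSpace ℝ (Fin d) → ℝ)
    (x : EuclideanSpace ℝ (Fin d)) : ‖fderiv ℝ F x‖ = ‖gradient F x‖ := by
  simp [gradient]

lemma norm_fderiv_sub_eq {d : ℕ} (F G : EuclideanSpace ℝ (Fin d) → ℝ)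
    (x : EuclideanSpace ℝ (Fin d)) :
    ‖fderiv ℝ F x - fderiv ℝ G x‖ = ‖gradient F x - gradient G x‖ := by
  rw [gradient, gradient, ← map_sub, LinearIsometryEquiv.norm_map]

lemma LSmooth.norm_gradient_le {d : ℕ} {M : ℝ} {F : EuclideanSpace ℝ (Fin d) → ℝ}
    (hF : LSmooth d M F) (x : EuclideanSpace ℝ (Fin d)) :
    ‖gradient F x‖ ≤ ‖gradient F 0‖ + M * ‖x‖ := by
  have h1 := hF x 0
  have h2 := norm_sub_norm_le (gradient F x) (gradient F 0)
  rw [sub_zero] at h1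
  linarith

lemma LSmooth.continuous_gradient {d : ℕ} {M : ℝ} {F : EuclideanSpace ℝ (Fin d) → ℝ}
    (hF : LSmooth d M F) : Continuous (gradient F) := by
  refine (LipschitzWith.of_dist_le_mul (K := M.toNNReal) fun x y => ?_).continuous
  rw [dist_eq_norm, dist_eq_norm]
  refine (hF x y).trans ?_
  gcongr
  exact le_coe_toNNReal M

/-- The Lyapunov inequality for the weight `‖x‖ ^ 2`. -/
lemma Dissipative.integral_norm_sq_mul_le {d : ℕ} {m b M β : ℝ} (hM : 0 ≤ M) (hβ : 0 ≤ β)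
    {F P u : EuclideanSpace ℝ (Fin d) → ℝ} (hFd : Dissipative d m b F) (hFs : LSmooth d M F)
    (hP : ContDiff ℝ 1 P) (hP0 : ∀ x, 0 ≤ P x)
    (hPF : ∀ x, fderiv ℝ P x = -(β * P x) • fderiv ℝ F x)
    (hu : ContDiff ℝ 1 u) (hu0 : ∀ x, 0 ≤ u x)
    (h2 : Integrable fun x => (1 + ‖x‖) ^ 2 * (u x * P x))
    (h1 : Integrable fun x => ‖x‖ * (‖fderiv ℝ u x‖ * P x)) :
    β * m * ∫ x, ‖x‖ ^ 2 * (u x * P x) ≤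
      (β * b + d) * (∫ x, u x * P x) + ∫ x, ‖x‖ * (‖fderiv ℝ u x‖ * P x) := by
  have huc := hu.continuous
  have hPc := hP.continuous
  have hufc : Continuous (fderiv ℝ u) := hu.continuous_fderiv one_ne_zero
  have hgc := hFs.continuous_gradient
  have hPos : ∀ x, 0 ≤ u x * P x := fun x => mul_nonneg (hu0 x) (hP0 x)
  have i0 : Integrable fun x => u x * P x := by
    refine h2.mono' (Continuous.aestronglyMeasurable (by fun_prop)) (.of_forall fun x => ?_)
    rw [norm_of_nonneg (hPos x)]
    nlinarith [norm_nonneg x, hPos x, mul_nonneg (norm_nonneg x) (hPos x),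
      mul_nonneg (sq_nonneg ‖x‖) (hPos x)]
  have i1 : Integrable fun x => ‖x‖ * (u x * P x) := by
    refine h2.mono' (Continuous.aestronglyMeasurable (by fun_prop)) (.of_forall fun x => ?_)
    rw [norm_of_nonneg (mul_nonneg (norm_nonneg x) (hPos x))]
    nlinarith [norm_nonneg x, hPos x, mul_nonneg (norm_nonneg x) (hPos x),
      mul_nonneg (sq_nonneg ‖x‖) (hPos x)]
  have i2 : Integrable fun x => ‖x‖ ^ 2 * (u x * P x) := by
    refine h2.mono' (Continuous.aestronglyMeasurable (by fun_prop)) (.of_forall fun x => ?_)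
    rw [norm_of_nonneg (mul_nonneg (sq_nonneg _) (hPos x))]
    nlinarith [norm_nonneg x, hPos x, mul_nonneg (norm_nonneg x) (hPos x),
      mul_nonneg (sq_nonneg ‖x‖) (hPos x)]
  have hfd : ∀ x, fderiv ℝ (fun x => u x * P x) x =
      P x • fderiv ℝ u x - (β * (u x * P x)) • fderiv ℝ F x := by
    intro x
    rw [fderiv_fun_mul (hu.differentiable one_ne_zero x) (hP.differentiable one_ne_zero x), hPF]
    module
  have hbd : ∀ x, ‖x‖ * ‖fderiv ℝ (fun x => u x * P x) x‖ ≤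
      ‖x‖ * (‖fderiv ℝ u x‖ * P x) +
        β * (‖gradient F 0‖ + M) * ((1 + ‖x‖) ^ 2 * (u x * P x)) := by
    intro x
    have e1 : ‖fderiv ℝ (fun x => u x * P x) x‖ ≤
        ‖fderiv ℝ u x‖ * P x + β * (u x * P x) * (‖gradient F 0‖ + M * ‖x‖) := by
      rw [hfd]
      refine (norm_sub_le _ _).trans ?_
      rw [norm_smul, norm_smul, norm_of_nonneg (hP0 x),
        norm_of_nonneg (mul_nonneg hβ (hPos x)), mul_comm (P x), norm_fderiv_eq_norm_gradient F]
      have := hFs.norm_gradient_le x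
      gcongr
      exact mul_nonneg hβ (hPos x)
    have e2 : ‖x‖ * (‖gradient F 0‖ + M * ‖x‖) ≤ (‖gradient F 0‖ + M) * (1 + ‖x‖) ^ 2 := by
      nlinarith [norm_nonneg x, norm_nonneg (gradient F 0), mul_nonneg (norm_nonneg x) hM,
        mul_nonneg (norm_nonneg x) (norm_nonneg (gradient F 0)),
        mul_nonneg (sq_nonneg ‖x‖) (norm_nonneg (gradient F 0))]
    calc _ ≤ ‖x‖ * (‖fderiv ℝ u x‖ * P x + β * (u x * P x) * (‖gradient F 0‖ + M * ‖x‖)) := by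
          gcongr
      _ = ‖x‖ * (‖fderiv ℝ u x‖ * P x) +
          β * (u x * P x) * (‖x‖ * (‖gradient F 0‖ + M * ‖x‖)) := by ring
      _ ≤ ‖x‖ * (‖fderiv ℝ u x‖ * P x) +
          β * (u x * P x) * ((‖gradient F 0‖ + M) * (1 + ‖x‖) ^ 2) := by
          gcongr
          exact mul_nonneg hβ (hPos x)
      _ = _ := by ring
  have hw : ContDiff ℝ 1 fun x => u x * P x := hu.mul hP
  have hwfc : Continuous (fderiv ℝ fun x => u x * P x) := hw.continuous_fderiv one_ne_zero
  have hdiv := integral_fderiv_apply_self hw i0 i1 <| by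
    refine (h1.add (h2.const_mul (β * (‖gradient F 0‖ + M)))).mono'
      (Continuous.aestronglyMeasurable (by fun_prop)) (.of_forall fun x => ?_)
    rw [norm_mul, norm_norm, norm_norm]
    exact hbd x
  have hle : ∫ x, fderiv ℝ (fun x => u x * P x) x x ≤
      ∫ x, (‖x‖ * (‖fderiv ℝ u x‖ * P x) + (β * b) * (u x * P x) -
        (β * m) * (‖x‖ ^ 2 * (u x * P x))) := by
    refine integral_mono ?_ ((h1.add (i0.const_mul _)).sub (i2.const_mul _)) fun x => ?_
    · refine (h1.add (h2.const_mul (β * (‖gradient F 0‖ + M)))).mono'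
        (Continuous.aestronglyMeasurable (by fun_prop)) (.of_forall fun x => ?_)
      refine (ContinuousLinearMap.le_opNorm _ _).trans ?_
      rw [mul_comm]
      exact hbd x
    · simp only [hfd, sub_apply, smul_apply, smul_eq_mul]
      have e1 : fderiv ℝ u x x ≤ ‖fderiv ℝ u x‖ * ‖x‖ :=
        (le_abs_self _).trans ((fderiv ℝ u x).le_opNorm x)
      have e2 := hFd x
      rw [← fderiv_eq_inner_gradient] at e2
      nlinarith [mul_le_mul_of_nonneg_left e1 (hP0 x),
        mul_le_mul_of_nonneg_left e2 (mul_nonneg hβ (hPos x))]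
  have i3 : Integrable fun x => ‖x‖ * (‖fderiv ℝ u x‖ * P x) + (β * b) * (u x * P x) :=
    h1.add (i0.const_mul _)
  rw [hdiv, integral_sub i3 (i2.const_mul _), integral_add h1 (i0.const_mul _),
    integral_const_mul, integral_const_mul] at hle
  linarith

/-- Dissipativity and nonnegativity force quadratic growth. -/
lemma Dissipative.le_apply {d : ℕ} {m b : ℝ} (hm : 0 < m) (hb : 0 < b)
    {F : EuclideanSpace ℝ (Fin d) → ℝ} (hF : ContDiff ℝ 1 F) (hF0 : ∀ x, 0 ≤ F x)
    (hFd : Dissipative d m b F) (x : EuclideanSpace ℝ (Fin d)) :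
    m / 4 * ‖x‖ ^ 2 - b ≤ F x := by
  have hd : ∀ t : ℝ, HasDerivAt (fun t : ℝ => F (t • x)) (fderiv ℝ F (t • x) x) t := by
    intro t
    have h1 : HasDerivAt (fun t : ℝ => t • x) x t := by
      simpa using (hasDerivAt_id t).smul_const x
    exact ((hF.differentiable one_ne_zero _).hasFDerivAt).comp_hasDerivAt t h1
  obtain ⟨t, ht, hder⟩ := exists_hasDerivAt_eq_slope (fun t : ℝ => F (t • x)) _
    (show (1/2 : ℝ) < 1 by norm_num) (fun t _ => (hd t).continuousAt.continuousWithinAt)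
    (fun t _ => hd t)
  have h2 := hFd (t • x)
  rw [← fderiv_eq_inner_gradient, map_smul, smul_eq_mul, norm_smul, norm_eq_abs, mul_pow,
    sq_abs, hder] at h2
  have h3 := hF0 ((1 / 2 : ℝ) • x)
  obtain ⟨ht1, ht2⟩ := ht
  have h6 : ∀ a c : ℝ, t * ((a - c) / (1 - 1 / 2)) = 2 * (t * a) - 2 * (t * c) :=
    fun a c => by ring
  simp only [one_smul, h6] at h2
  have h4 : (m * ‖x‖ ^ 2 / 2) * t - b ≤ 2 * (t * F x) - 2 * (t * F ((1 / 2 : ℝ) • x)) := by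
    nlinarith [mul_nonneg hm.le (sq_nonneg ‖x‖), mul_nonneg (mul_nonneg hm.le (sq_nonneg ‖x‖))
      (mul_nonneg (by linarith : 0 ≤ t) (by linarith : 0 ≤ t - 1/2))]
  have h5 : (m * ‖x‖ ^ 2 / 2) * t - 2 * b * t ≤ 2 * (t * F x) := by
    nlinarith [mul_nonneg (by linarith : 0 ≤ t) h3]
  nlinarith

lemma integrable_one_add_norm_sq_mul_exp {d : ℕ} {s : ℝ} (hs : 0 < s) :
    Integrable fun x : EuclideanSpace ℝ (Fin d) => (1 + ‖x‖) ^ 2 * exp (-s * ‖x‖ ^ 2) := by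
  have hg : Integrable fun x : EuclideanSpace ℝ (Fin d) => exp (-(s / 2) * ‖x‖ ^ 2) := by
    have := (GaussianFourier.integrable_cexp_neg_mul_sq_norm_add
      (V := EuclideanSpace ℝ (Fin d)) (b := ((s / 2 : ℝ) : ℂ)) (by simpa using hs) 0 0).re
    refine this.congr (.of_forall fun x => ?_)
    simp only [zero_mul, add_zero]
    have : (-((s / 2 : ℝ) : ℂ) * (‖x‖ : ℂ) ^ 2) = ((-(s / 2) * ‖x‖ ^ 2 : ℝ) : ℂ) := by push_cast; rfl
    rw [this, ← Complex.ofReal_exp]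
    exact Complex.ofReal_re _
  refine (hg.const_mul (2 + 4 / s)).mono' (Continuous.aestronglyMeasurable (by fun_prop))
    (.of_forall fun x => ?_)
  rw [norm_of_nonneg (by positivity)]
  have h1 : s / 2 * ‖x‖ ^ 2 ≤ exp (s / 2 * ‖x‖ ^ 2) := by
    linarith [add_one_le_exp (s / 2 * ‖x‖ ^ 2)]
  have h2 : 1 ≤ exp (s / 2 * ‖x‖ ^ 2) := one_le_exp (by positivity)
  have h3 : (1 + ‖x‖) ^ 2 ≤ (2 + 4 / s) * exp (s / 2 * ‖x‖ ^ 2) := by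
    have : ‖x‖ ^ 2 ≤ 2 / s * exp (s / 2 * ‖x‖ ^ 2) := by
      calc ‖x‖ ^ 2 = 2 / s * (s / 2 * ‖x‖ ^ 2) := by field_simp
        _ ≤ _ := by gcongr
    have e : 4 / s = 2 * (2 / s) := by ring
    rw [e]
    nlinarith [sq_nonneg (1 - ‖x‖)]
  calc _ ≤ (2 + 4 / s) * exp (s / 2 * ‖x‖ ^ 2) * exp (-s * ‖x‖ ^ 2) := by gcongr
    _ = _ := by rw [mul_assoc, ← exp_add]; ring_nf

/-- Nonnegative, dissipative and smooth potentials. -/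
structure IsPotential (d : ℕ) (m b M : ℝ) (F : EuclideanSpace ℝ (Fin d) → ℝ) : Prop where
  contDiff : ContDiff ℝ 1 F
  nonneg : ∀ x, 0 ≤ F x
  dissipative : Dissipative d m b F
  smooth : LSmooth d M F

/-- The Lebesgue density of the Gibbs measure. -/
def gibbsDensity (d : ℕ) (β : ℝ) (F : EuclideanSpace ℝ (Fin d) → ℝ)
    (x : EuclideanSpace ℝ (Fin d)) : ℝ :=
  exp (-β * F x) / ∫ y, exp (-β * F y)

namespace IsPotential

variable {d : ℕ} {m b M β : ℝ} {F G : EuclideanSpace ℝ (Fin d) → ℝ}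

lemma integrable_weight_exp (hF : IsPotential d m b M F) (hm : 0 < m) (hb : 0 < b) (hβ : 0 < β) :
    Integrable fun x => (1 + ‖x‖) ^ 2 * exp (-β * F x) := by
  have hc := hF.contDiff.continuous
  refine ((integrable_one_add_norm_sq_mul_exp (d := d) (s := β * m / 4)
    (by positivity)).const_mul (exp (β * b))).mono'
    (Continuous.aestronglyMeasurable (by fun_prop)) (.of_forall fun x => ?_)
  rw [norm_of_nonneg (by positivity), mul_left_comm, ← exp_add]
  have := hF.dissipative.le_apply hm hb hF.contDiff hF.nonneg x
  gcongr
  nlinarith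

lemma integrable_exp (hF : IsPotential d m b M F) (hm : 0 < m) (hb : 0 < b) (hβ : 0 < β) :
    Integrable fun x => exp (-β * F x) := by
  have hc := hF.contDiff.continuous
  refine (hF.integrable_weight_exp hm hb hβ).mono'
    (Continuous.aestronglyMeasurable (by fun_prop)) (.of_forall fun x => ?_)
  rw [norm_of_nonneg (exp_pos _).le]
  exact le_mul_of_one_le_left (exp_pos _).le (one_le_pow₀ (by linarith [norm_nonneg x]))

lemma partition_pos (hF : IsPotential d m b M F) (hm : 0 < m) (hb : 0 < b) (hβ : 0 < β) :
    0 < ∫ x, exp (-β * F x) :=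
  integral_exp_pos (hF.integrable_exp hm hb hβ)

lemma density_pos (hF : IsPotential d m b M F) (hm : 0 < m) (hb : 0 < b) (hβ : 0 < β)
    (x : EuclideanSpace ℝ (Fin d)) : 0 < gibbsDensity d β F x :=
  div_pos (exp_pos _) (hF.partition_pos hm hb hβ)

lemma contDiff_density (hF : IsPotential d m b M F) : ContDiff ℝ 1 (gibbsDensity d β F) :=
  ((contDiff_const.mul hF.contDiff).exp).div_const _

lemma fderiv_density (hF : IsPotential d m b M F) (x : EuclideanSpace ℝ (Fin d)) :
    fderiv ℝ (gibbsDensity d β F) x = -(β * gibbsDensity d β F x) • fderiv ℝ F x := by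
  have h1 := (hF.contDiff.differentiable one_ne_zero x).hasFDerivAt
  have h2 := ((h1.const_mul (-β)).exp).mul_const (∫ y, exp (-β * F y))⁻¹
  have h3 : fderiv ℝ (gibbsDensity d β F) x = _ := h2.fderiv
  rw [h3, smul_smul, smul_smul]
  congr 1
  rw [gibbsDensity]
  ring

lemma integrable_weight (hF : IsPotential d m b M F) (hm : 0 < m) (hb : 0 < b) (hβ : 0 < β) :
    Integrable fun x => (1 + ‖x‖) ^ 2 * gibbsDensity d β F x := by
  refine ((hF.integrable_weight_exp hm hb hβ).div_const (∫ y, exp (-β * F y))).congr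
    (.of_forall fun x => ?_)
  simp only [gibbsDensity]
  ring

lemma integrable_density (hF : IsPotential d m b M F) (hm : 0 < m) (hb : 0 < b) (hβ : 0 < β) :
    Integrable (gibbsDensity d β F) :=
  (hF.integrable_exp hm hb hβ).div_const _

lemma integral_density (hF : IsPotential d m b M F) (hm : 0 < m) (hb : 0 < b) (hβ : 0 < β) :
    ∫ x, gibbsDensity d β F x = 1 := by
  simp only [gibbsDensity]
  rw [integral_div, div_self (hF.partition_pos hm hb hβ).ne']

lemma integral_norm_sq_mul_density_le (hF : IsPotential d m b M F) (hm : 0 < m) (hb : 0 < b)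
    (hM : 0 < M) (hβ : 0 < β) :
    ∫ x, ‖x‖ ^ 2 * gibbsDensity d β F x ≤ (β * b + d) / (β * m) := by
  have := hF.dissipative.integral_norm_sq_mul_le hM.le hβ.le hF.smooth hF.contDiff_density
    (fun x => (hF.density_pos hm hb hβ x).le) hF.fderiv_density (u := fun _ => 1)
    contDiff_const (fun _ => zero_le_one) (by simpa using hF.integrable_weight hm hb hβ)
    (by simp)
  simp only [one_mul, hF.integral_density hm hb hβ, fderiv_const_apply, norm_zero, zero_mul,
    mul_zero, integral_zero, add_zero, mul_one] at this
  rw [le_div_iff₀ (by positivity)]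
  linarith

lemma abs_sub_apply_zero_le (hF : IsPotential d m b M F) (hM : 0 < M) {R : ℝ}
    {x : EuclideanSpace ℝ (Fin d)} (hx : x ∈ Metric.closedBall 0 R) :
    |F x - F 0| ≤ (‖gradient F 0‖ + M * R) * R := by
  have hR : ‖x‖ ≤ R := by simpa using hx
  have h0 : 0 ≤ R := (norm_nonneg x).trans hR
  have := (convex_closedBall (0 : EuclideanSpace ℝ (Fin d)) R).norm_image_sub_le_of_norm_fderiv_le
    (𝕜 := ℝ) (f := F) (C := ‖gradient F 0‖ + M * R)
    (fun y _ => hF.contDiff.differentiable one_ne_zero y) (fun y hy => by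
      rw [norm_fderiv_eq_norm_gradient]
      refine (hF.smooth.norm_gradient_le y).trans ?_
      have : ‖y‖ ≤ R := by simpa using hy
      gcongr) (Metric.mem_closedBall_self h0) hx
  rw [sub_zero] at this
  refine this.trans ?_
  gcongr

lemma density_le (hF : IsPotential d m b M F) (hm : 0 < m) (hb : 0 < b) (hM : 0 < M)
    (hβ : 0 < β) {R : ℝ} {x : EuclideanSpace ℝ (Fin d)} (hx : x ∈ Metric.closedBall 0 R) :
    gibbsDensity d β F x ≤ exp (β * ((‖gradient F 0‖ + M * R) * R)) * gibbsDensity d β F 0 ∧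
    gibbsDensity d β F 0 ≤ exp (β * ((‖gradient F 0‖ + M * R) * R)) * gibbsDensity d β F x := by
  have h := abs_le.1 (hF.abs_sub_apply_zero_le hM hx)
  have hZ := hF.partition_pos hm hb hβ
  constructor
  · rw [gibbsDensity, gibbsDensity, ← mul_div_assoc, ← exp_add]
    gcongr
    nlinarith
  · rw [gibbsDensity, gibbsDensity, ← mul_div_assoc, ← exp_add]
    gcongr
    nlinarith

lemma norm_fderiv_ratio_mul (hF : IsPotential d m b M F) (hG : IsPotential d m b M G)
    (hm : 0 < m) (hb : 0 < b) (hβ : 0 < β) (x : EuclideanSpace ℝ (Fin d)) :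
    ‖fderiv ℝ (fun x => gibbsDensity d β G x / gibbsDensity d β F x) x‖ * gibbsDensity d β F x =
      β * (‖gradient F x - gradient G x‖ * gibbsDensity d β G x) := by
  have hP := hF.density_pos hm hb hβ
  have hQ := hG.density_pos hm hb hβ
  have hd : fderiv ℝ (fun x => gibbsDensity d β G x / gibbsDensity d β F x) x =
      (β * (gibbsDensity d β G x / gibbsDensity d β F x)) • (fderiv ℝ F x - fderiv ℝ G x) := by
    have h1 := ((hG.contDiff_density (β := β)).differentiable one_ne_zero x).hasFDerivAt.mul
      ((hasDerivAt_inv (hP x).ne').comp_hasFDerivAt x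
        ((hF.contDiff_density (β := β)).differentiable one_ne_zero x).hasFDerivAt)
    have h2 : (fun x => gibbsDensity d β G x / gibbsDensity d β F x) =
        gibbsDensity d β G * (Inv.inv ∘ gibbsDensity d β F) := by
      ext y
      simp [div_eq_mul_inv]
    rw [h2, h1.fderiv, hG.fderiv_density, hF.fderiv_density]
    ext v
    simp only [smul_apply, sub_apply, add_apply, smul_eq_mul, Function.comp_apply]
    have := (hP x).ne'
    field_simp
    ring
  rw [hd, norm_smul, norm_fderiv_sub_eq,
    norm_of_nonneg (mul_nonneg hβ.le (div_pos (hQ x) (hP x)).le)]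
  have := (hP x).ne'
  field_simp

lemma integrable_weight_norm_gradient_sub (hF : IsPotential d m b M F)
    (hG : IsPotential d m b M G) (hm : 0 < m) (hb : 0 < b) (hM : 0 < M) (hβ : 0 < β) :
    Integrable fun x => (1 + ‖x‖) *
      (‖gradient F x - gradient G x‖ * gibbsDensity d β G x) := by
  have hFc := hF.smooth.continuous_gradient
  have hGc := hG.smooth.continuous_gradient
  have hQc := (hG.contDiff_density (β := β)).continuous
  refine ((hG.integrable_weight hm hb hβ).const_mul
    (‖gradient F 0‖ + ‖gradient G 0‖ + 2 * M)).mono'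
    (Continuous.aestronglyMeasurable (by fun_prop)) (.of_forall fun x => ?_)
  have hQ := (hG.density_pos hm hb hβ x).le
  rw [norm_of_nonneg (by positivity)]
  have h1 : ‖gradient F x - gradient G x‖ ≤
      (‖gradient F 0‖ + ‖gradient G 0‖ + 2 * M) * (1 + ‖x‖) := by
    have h2 := norm_sub_le (gradient F x) (gradient G x)
    have h3 := hF.smooth.norm_gradient_le x
    have h4 := hG.smooth.norm_gradient_le x
    nlinarith [mul_nonneg (norm_nonneg (gradient F 0)) (norm_nonneg x),
      mul_nonneg (norm_nonneg (gradient G 0)) (norm_nonneg x)]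
  calc _ ≤ (1 + ‖x‖) * ((‖gradient F 0‖ + ‖gradient G 0‖ + 2 * M) * (1 + ‖x‖) *
        gibbsDensity d β G x) := by gcongr
    _ = _ := by ring

lemma integrable_weight_abs_sub (hF : IsPotential d m b M F) (hG : IsPotential d m b M G)
    (hm : 0 < m) (hb : 0 < b) (hβ : 0 < β) (c : ℝ) :
    Integrable fun x => (1 + ‖x‖) ^ 2 * |gibbsDensity d β G x - c * gibbsDensity d β F x| := by
  have hPc := (hF.contDiff_density (β := β)).continuous
  have hQc := (hG.contDiff_density (β := β)).continuous
  refine ((hG.integrable_weight hm hb hβ).add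
    ((hF.integrable_weight hm hb hβ).const_mul |c|)).mono'
    (Continuous.aestronglyMeasurable (by fun_prop)) (.of_forall fun x => ?_)
  rw [norm_of_nonneg (by positivity)]
  have h1 := abs_sub (gibbsDensity d β G x) (c * gibbsDensity d β F x)
  rw [abs_mul, abs_of_pos (hF.density_pos hm hb hβ x),
    abs_of_pos (hG.density_pos hm hb hβ x)] at h1
  calc _ ≤ (1 + ‖x‖) ^ 2 * (gibbsDensity d β G x + |c| * gibbsDensity d β F x) := by gcongr
    _ = _ := by simp only [Pi.add_apply]; ring

lemma integrable_norm_pow_mul_abs_sub (hF : IsPotential d m b M F) (hG : IsPotential d m b M G)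
    (hm : 0 < m) (hb : 0 < b) (hβ : 0 < β) (c : ℝ) {n : ℕ} (hn : n ≤ 2) :
    Integrable fun x => ‖x‖ ^ n * |gibbsDensity d β G x - c * gibbsDensity d β F x| := by
  have hPc := (hF.contDiff_density (β := β)).continuous
  have hQc := (hG.contDiff_density (β := β)).continuous
  refine (hF.integrable_weight_abs_sub hG hm hb hβ c).mono'
    (Continuous.aestronglyMeasurable (by fun_prop)) (.of_forall fun x => ?_)
  rw [norm_of_nonneg (by positivity)]
  have h0 := norm_nonneg x
  gcongr
  calc ‖x‖ ^ n ≤ (1 + ‖x‖) ^ n := by gcongr; linarith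
    _ ≤ (1 + ‖x‖) ^ 2 := pow_le_pow_right₀ (by linarith) hn

/-- The Lyapunov inequality applied to the signed combination of two Gibbs densities. -/
lemma integral_norm_sq_mul_abs_sub_le (hF : IsPotential d m b M F) (hG : IsPotential d m b M G)
    (hm : 0 < m) (hb : 0 < b) (hM : 0 < M) (hβ : 0 < β) (c : ℝ) :
    β * m * ∫ x, ‖x‖ ^ 2 * |gibbsDensity d β G x - c * gibbsDensity d β F x| ≤
      (β * b + d) * (∫ x, |gibbsDensity d β G x - c * gibbsDensity d β F x|) +
      β * ∫ x, (1 + ‖x‖) * (‖gradient F x - gradient G x‖ * gibbsDensity d β G x) := by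
  set P := gibbsDensity d β F with hPdef
  set Q := gibbsDensity d β G with hQdef
  have hP : ∀ x, 0 < P x := hF.density_pos hm hb hβ
  have hPC : ContDiff ℝ 1 P := hF.contDiff_density
  have hQC : ContDiff ℝ 1 Q := hG.contDiff_density
  have hPc := hPC.continuous
  have hQc := hQC.continuous
  have hFc := hF.smooth.continuous_gradient
  have hGc := hG.smooth.continuous_gradient
  have hi0 : Integrable fun x => |Q x - c * P x| := by
    simpa using hF.integrable_norm_pow_mul_abs_sub hG hm hb hβ c (n := 0) (by norm_num)
  have hi2 : Integrable fun x => ‖x‖ ^ 2 * |Q x - c * P x| :=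
    hF.integrable_norm_pow_mul_abs_sub hG hm hb hβ c le_rfl
  have hik := hF.integrable_weight_norm_gradient_sub hG hm hb hM hβ
  set h : EuclideanSpace ℝ (Fin d) → ℝ := fun x => Q x / P x with hdef
  have hC : ContDiff ℝ 1 h := hQC.div hPC fun x => (hP x).ne'
  have habs : ∀ x, |h x - c| * P x = |Q x - c * P x| := by
    intro x
    rw [← abs_of_pos (hP x), ← abs_mul, abs_of_pos (hP x), sub_mul, hdef,
      div_mul_cancel₀ _ (hP x).ne']
  have hgrad : ∀ x, ‖fderiv ℝ h x‖ * P x = β * (‖gradient F x - gradient G x‖ * Q x) :=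
    hF.norm_fderiv_ratio_mul hG hm hb hβ
  refine le_of_forall_pos_le_add fun η hη => ?_
  obtain ⟨ε, hε, hεη⟩ : ∃ ε > 0, (β * b + d) * ε ≤ η := by
    refine ⟨η / (β * b + d), by positivity, le_of_eq ?_⟩
    field_simp
  set u : EuclideanSpace ℝ (Fin d) → ℝ := fun x => √((h x - c) ^ 2 + ε ^ 2) with hu
  have hpos : ∀ x, 0 < (h x - c) ^ 2 + ε ^ 2 := fun x => by positivity
  have huC : ContDiff ℝ 1 u :=
    (((hC.sub contDiff_const).pow 2).add contDiff_const).sqrt fun x => (hpos x).ne'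
  have hle : ∀ x, |h x - c| ≤ u x := fun x => by
    rw [hu, ← sqrt_sq_eq_abs]
    exact sqrt_le_sqrt (by nlinarith)
  have hge : ∀ x, u x ≤ |h x - c| + ε := fun x => by
    rw [hu]
    refine sqrt_le_iff.2 ⟨by positivity, ?_⟩
    nlinarith [sq_abs (h x - c), mul_nonneg (abs_nonneg (h x - c)) hε.le]
  have hfd : ∀ x, ‖fderiv ℝ u x‖ ≤ ‖fderiv ℝ h x‖ := fun x => by
    have h1 := ((((hC.differentiable one_ne_zero x).hasFDerivAt.sub_const c).pow 2).add_const
      (ε ^ 2)).sqrt (hpos x).ne'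
    have h2 : fderiv ℝ u x = _ := h1.fderiv
    have h3 : (1 / (2 * √((h x - c) ^ 2 + ε ^ 2))) * ((2 : ℕ) * (h x - c) ^ (2 - 1)) =
        (h x - c) / u x := by
      simp only [hu]
      push_cast
      field_simp
    rw [h2]
    have h4 : (1 / (2 * √((h x - c) ^ 2 + ε ^ 2))) •
        (((2 : ℕ) * (h x - c) ^ (2 - 1)) • fderiv ℝ h x) = ((h x - c) / u x) • fderiv ℝ h x := by
      rw [smul_smul, h3]
    have hux : 0 < u x := sqrt_pos.2 (hpos x)
    have h5 : ‖((h x - c) / u x) • fderiv ℝ h x‖ ≤ ‖fderiv ℝ h x‖ := by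
      rw [norm_smul, norm_div, norm_of_nonneg hux.le]
      exact mul_le_of_le_one_left (norm_nonneg _) ((div_le_one hux).2 (hle x))
    convert! h5 using 2
    rw [← h4]
    simp
  have huP : ∀ x, u x * P x ≤ |Q x - c * P x| + ε * P x := fun x => by
    rw [← habs, ← add_mul]
    exact mul_le_mul_of_nonneg_right (hge x) (hP x).le
  have hPu : ∀ x, |Q x - c * P x| ≤ u x * P x := fun x => by
    rw [← habs]
    exact mul_le_mul_of_nonneg_right (hle x) (hP x).le
  have huc := huC.continuous
  have hufc : Continuous (fderiv ℝ u) := huC.continuous_fderiv one_ne_zero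
  have hu0 : ∀ x, 0 ≤ u x := fun x => sqrt_nonneg _
  have hkbd : ∀ x, ‖x‖ * (‖fderiv ℝ u x‖ * P x) ≤
      β * ((1 + ‖x‖) * (‖gradient F x - gradient G x‖ * Q x)) := fun x => by
    have h1 : ‖fderiv ℝ u x‖ * P x ≤ β * (‖gradient F x - gradient G x‖ * Q x) := by
      rw [← hgrad]
      exact mul_le_mul_of_nonneg_right (hfd x) (hP x).le
    have h2 : 0 ≤ ‖fderiv ℝ u x‖ * P x := mul_nonneg (norm_nonneg _) (hP x).le
    nlinarith [norm_nonneg x]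
  have j1 : Integrable fun x => ‖x‖ * (‖fderiv ℝ u x‖ * P x) := by
    refine (hik.const_mul β).mono' (Continuous.aestronglyMeasurable (by fun_prop))
      (.of_forall fun x => ?_)
    rw [norm_of_nonneg (mul_nonneg (norm_nonneg _) (mul_nonneg (norm_nonneg _) (hP x).le))]
    exact hkbd x
  have j2 : Integrable fun x => (1 + ‖x‖) ^ 2 * (u x * P x) := by
    refine ((hF.integrable_weight_abs_sub hG hm hb hβ c).add
      ((hF.integrable_weight hm hb hβ).const_mul ε)).mono'
      (Continuous.aestronglyMeasurable (by fun_prop)) (.of_forall fun x => ?_)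
    rw [norm_of_nonneg (mul_nonneg (by positivity) (mul_nonneg (hu0 x) (hP x).le))]
    calc _ ≤ (1 + ‖x‖) ^ 2 * (|Q x - c * P x| + ε * P x) := by
          gcongr
          exact huP x
      _ = _ := by simp only [Pi.add_apply]; ring
  have hmain := hF.dissipative.integral_norm_sq_mul_le hM.le hβ.le hF.smooth hPC
    (fun x => (hP x).le) hF.fderiv_density huC hu0 j2 j1
  have j3 : Integrable fun x => u x * P x := by
    refine j2.mono' (Continuous.aestronglyMeasurable (by fun_prop)) (.of_forall fun x => ?_)
    rw [norm_of_nonneg (mul_nonneg (hu0 x) (hP x).le)]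
    exact le_mul_of_one_le_left (mul_nonneg (hu0 x) (hP x).le)
      (one_le_pow₀ (by linarith [norm_nonneg x]))
  have j4 : Integrable fun x => ‖x‖ ^ 2 * (u x * P x) := by
    refine j2.mono' (Continuous.aestronglyMeasurable (by fun_prop)) (.of_forall fun x => ?_)
    rw [norm_of_nonneg (mul_nonneg (by positivity) (mul_nonneg (hu0 x) (hP x).le))]
    refine mul_le_mul_of_nonneg_right ?_ (mul_nonneg (hu0 x) (hP x).le)
    gcongr
    linarith [norm_nonneg x]
  have e1 : ∫ x, ‖x‖ ^ 2 * |Q x - c * P x| ≤ ∫ x, ‖x‖ ^ 2 * (u x * P x) :=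
    integral_mono hi2 j4 fun x => mul_le_mul_of_nonneg_left (hPu x) (by positivity)
  have hPi : Integrable P := hF.integrable_density hm hb hβ
  have e2 : ∫ x, u x * P x ≤ (∫ x, |Q x - c * P x|) + ε := by
    have := integral_mono j3 (hi0.add (hPi.const_mul ε)) huP
    refine this.trans (le_of_eq ?_)
    rw [integral_add' hi0 (hPi.const_mul ε), integral_const_mul, hF.integral_density hm hb hβ,
      mul_one]
  have e3 : ∫ x, ‖x‖ * (‖fderiv ℝ u x‖ * P x) ≤
      β * ∫ x, (1 + ‖x‖) * (‖gradient F x - gradient G x‖ * Q x) := by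
    rw [← integral_const_mul]
    exact integral_mono j1 (hik.const_mul β) hkbd
  have f1 := mul_le_mul_of_nonneg_left e1 (by positivity : 0 ≤ β * m)
  have f2 := mul_le_mul_of_nonneg_left e2 (by positivity : 0 ≤ β * b + d)
  linarith

end IsPotential

/-- Outside the ball of radius `R`, a constant `q ≤ R` is dominated by `‖x‖ ^ 2`. -/
lemma mul_integral_abs_le {E : Type*} [NormedAddCommGroup E] [MeasurableSpace E]
    [OpensMeasurableSpace E] {μ : Measure E} {u : E → ℝ} {q R : ℝ} (hR : 1 ≤ R) (hqR : q ≤ R)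
    (h0 : Integrable (fun x => |u x|) μ)
    (h2 : Integrable (fun x => ‖x‖ ^ 2 * |u x|) μ) :
    q * ∫ x, |u x| ∂μ ≤
      q * (∫ x in Metric.closedBall 0 R, |u x| ∂μ) + ∫ x, ‖x‖ ^ 2 * |u x| ∂μ := by
  have hB : MeasurableSet (Metric.closedBall (0 : E) R) := measurableSet_closedBall
  rw [← integral_indicator hB, ← integral_const_mul, ← integral_const_mul,
    ← integral_add ((h0.indicator hB).const_mul q) h2]
  refine integral_mono (h0.const_mul q) (((h0.indicator hB).const_mul q).add h2) fun x => ?_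
  have hu := abs_nonneg (u x)
  by_cases hx : x ∈ Metric.closedBall (0 : E) R
  · rw [Set.indicator_of_mem hx]
    have : 0 ≤ ‖x‖ ^ 2 * |u x| := by positivity
    linarith
  · rw [Set.indicator_of_notMem hx, mul_zero, zero_add]
    have hx' : R < ‖x‖ := by simpa using hx
    refine mul_le_mul_of_nonneg_right ?_ hu
    nlinarith

/-- Passing from `Q - c P` to `Q - P` for probability densities `P` and `Q`. -/
lemma integral_weight_mul_abs_sub_le {E : Type*} [NormedAddCommGroup E] [MeasurableSpace E]
    {μ : Measure E} {P Q : E → ℝ} {c : ℝ} (hP : ∀ x, 0 < P x) (hPi : Integrable P μ)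
    (hQi : Integrable Q μ) (hP1 : ∫ x, P x ∂μ = 1) (hQ1 : ∫ x, Q x ∂μ = 1)
    (h0 : Integrable (fun x => |Q x - c * P x|) μ)
    (h2 : Integrable (fun x => ‖x‖ ^ 2 * |Q x - c * P x|) μ)
    (hw : Integrable (fun x => (2 + ‖x‖ ^ 2) * |Q x - P x|) μ)
    (hP2 : Integrable (fun x => ‖x‖ ^ 2 * P x) μ) :
    ∫ x, (2 + ‖x‖ ^ 2) * |Q x - P x| ∂μ ≤
      2 * (∫ x, |Q x - c * P x| ∂μ) + (∫ x, ‖x‖ ^ 2 * |Q x - c * P x| ∂μ) +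
        (∫ x, |Q x - c * P x| ∂μ) * (2 + ∫ x, ‖x‖ ^ 2 * P x ∂μ) := by
  have hc1 : |1 - c| ≤ ∫ x, |Q x - c * P x| ∂μ := by
    have : 1 - c = ∫ x, (Q x - c * P x) ∂μ := by
      rw [integral_sub hQi (hPi.const_mul c), integral_const_mul, hP1, hQ1, mul_one]
    rw [this]
    exact abs_integral_le_integral_abs
  have j1 : Integrable (fun x => 2 * |Q x - c * P x| + ‖x‖ ^ 2 * |Q x - c * P x|) μ :=
    (h0.const_mul 2).add h2
  have j2 : Integrable (fun x => 2 * P x + ‖x‖ ^ 2 * P x) μ := (hPi.const_mul 2).add hP2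
  have hmono : ∫ x, (2 + ‖x‖ ^ 2) * |Q x - P x| ∂μ ≤
      ∫ x, (2 * |Q x - c * P x| + ‖x‖ ^ 2 * |Q x - c * P x| +
        (|1 - c| * (2 * P x + ‖x‖ ^ 2 * P x))) ∂μ := by
    refine integral_mono hw (j1.add (j2.const_mul _)) fun x => ?_
    have h1 : |Q x - P x| ≤ |Q x - c * P x| + |1 - c| * P x := by
      rw [abs_sub_comm 1 c, ← abs_of_pos (hP x), ← abs_mul, abs_of_pos (hP x)]
      refine le_trans (le_of_eq ?_) (abs_add_le _ _)
      ring_nf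
    calc _ ≤ (2 + ‖x‖ ^ 2) * (|Q x - c * P x| + |1 - c| * P x) := by
          gcongr
      _ = _ := by ring
  rw [integral_add j1 (j2.const_mul _), integral_add (h0.const_mul 2) h2,
    integral_const_mul, integral_const_mul, integral_add (hPi.const_mul 2) hP2,
    integral_const_mul, hP1, mul_one] at hmono
  have hnn : 0 ≤ ∫ x, ‖x‖ ^ 2 * P x ∂μ :=
    integral_nonneg fun x => mul_nonneg (sq_nonneg _) (hP x).le
  have := mul_le_mul_of_nonneg_right hc1 (by linarith : 0 ≤ 2 + ∫ x, ‖x‖ ^ 2 * P x ∂μ)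
  linarith

/-- Closing the Lyapunov estimate: `I₀`, `I₂`, `J` stand for the mass, the second moment and the
mass on a ball of the signed measure, `S` for a second moment and `T` for the target. -/
lemma weighted_bound_of_lyapunov {κ β D L T I₀ I₂ J S : ℝ} (hκ : 0 < κ) (hβ : 0 < β)
    (hD : 0 ≤ D) (hL : 0 ≤ L) (hT : 0 ≤ T) (hS0 : 0 ≤ S) (hJ : J ≤ L * T)
    (hlyap : κ * I₂ ≤ D * I₀ + β * T) (hS : S ≤ D / κ) (h1 : 1 * I₀ ≤ 1 * J + I₂)
    (h2 : 2 * D / κ * I₀ ≤ 2 * D / κ * J + I₂) :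
    2 * I₀ + I₂ + I₀ * (2 + S) ≤
      (2 * L + 3 * (2 / κ * (D * L + β))) * (3 + D / κ) * T := by
  obtain ⟨N, hN⟩ : ∃ N, N = 2 / κ * (D * L + β) := ⟨_, rfl⟩
  have hN0 : 0 ≤ N := by rw [hN]; positivity
  rw [← hN]
  have s3 : D * I₀ ≤ D * J + κ / 2 * I₂ := by
    have := mul_le_mul_of_nonneg_left h2 (by positivity : 0 ≤ κ / 2)
    have e : ∀ y, κ / 2 * (2 * D / κ * y) = D * y := fun y => by field_simp
    rwa [mul_add (κ / 2), e, e] at this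
  have s4 : I₂ ≤ N * T := by
    have h3 : κ / 2 * I₂ ≤ (D * L + β) * T := by nlinarith
    have h4 := mul_le_mul_of_nonneg_left h3 (by positivity : 0 ≤ 2 / κ)
    have e : 2 / κ * (κ / 2 * I₂) = I₂ := by field_simp
    rwa [e, ← mul_assoc, ← hN] at h4
  have s5 : I₀ ≤ (L + N) * T := by linarith
  have t1 : I₀ * (2 + S) ≤ (L + N) * T * (2 + D / κ) :=
    mul_le_mul s5 (by linarith) (by linarith) (by positivity)
  have hDκ : 0 ≤ D / κ := by positivity
  have t2 : (L + N) * T * (2 + D / κ) ≤ (2 * L + 3 * N) * T * (2 + D / κ) := by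
    gcongr <;> linarith
  calc _ ≤ (2 * L + 3 * N) * T + (2 * L + 3 * N) * T * (2 + D / κ) := by linarith
    _ = _ := by ring

namespace IsPotential

variable {d : ℕ} {m b M β : ℝ} {F G : EuclideanSpace ℝ (Fin d) → ℝ}

/-- A local `L¹` Poincaré inequality for the ratio of two Gibbs densities. -/
lemma exists_setIntegral_abs_sub_le (hF : IsPotential d m b M F) (hG : IsPotential d m b M G)
    (hm : 0 < m) (hb : 0 < b) (hM : 0 < M) (hβ : 0 < β) {R : ℝ} (hR : 0 < R) :
    ∃ c : ℝ, ∫ x in Metric.closedBall 0 R, |gibbsDensity d β G x - c * gibbsDensity d β F x| ≤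
      exp (β * ((‖gradient F 0‖ + M * R) * R)) ^ 2 * (2 * R * 2 ^ d) * β *
        ∫ x, (1 + ‖x‖) * (‖gradient F x - gradient G x‖ * gibbsDensity d β G x) := by
  set P := gibbsDensity d β F with hPdef
  set Q := gibbsDensity d β G with hQdef
  set K := exp (β * ((‖gradient F 0‖ + M * R) * R)) with hK
  have hK0 : 0 < K := exp_pos _
  have hP : ∀ x, 0 < P x := hF.density_pos hm hb hβ
  have hQ : ∀ x, 0 < Q x := hG.density_pos hm hb hβ
  have hPC : ContDiff ℝ 1 P := hF.contDiff_density
  have hQC : ContDiff ℝ 1 Q := hG.contDiff_density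
  have hPc := hPC.continuous
  have hQc := hQC.continuous
  have hik := hF.integrable_weight_norm_gradient_sub hG hm hb hM hβ
  set h : EuclideanSpace ℝ (Fin d) → ℝ := fun x => Q x / P x with hdef
  have hC : ContDiff ℝ 1 h := hQC.div hPC fun x => (hP x).ne'
  have hc := hC.continuous
  have hfc : Continuous (fderiv ℝ h) := hC.continuous_fderiv one_ne_zero
  have hgrad : ∀ x, ‖fderiv ℝ h x‖ * P x = β * (‖gradient F x - gradient G x‖ * Q x) :=
    hF.norm_fderiv_ratio_mul hG hm hb hβ
  set B : Set (EuclideanSpace ℝ (Fin d)) := Metric.closedBall 0 R with hB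
  have hBc : IsCompact B := isCompact_closedBall _ _
  have hBm : MeasurableSet B := measurableSet_closedBall
  obtain ⟨c, hcP⟩ := exists_lintegral_closedBall_sub_le hC hR
  refine ⟨c, ?_⟩
  have habs : ∀ x, |Q x - c * P x| = |h x - c| * P x := by
    intro x
    rw [← abs_of_pos (hP x), ← abs_mul, abs_of_pos (hP x), sub_mul, hdef,
      div_mul_cancel₀ _ (hP x).ne']
  have i1 : IntegrableOn (fun x => h x - c) B :=
    ContinuousOn.integrableOn_compact hBc (by fun_prop)
  have i2 : IntegrableOn (fderiv ℝ h) B := ContinuousOn.integrableOn_compact hBc (by fun_prop)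
  have hpoinc : ∫ x in B, |h x - c| ≤ 2 * R * 2 ^ d * ∫ x in B, ‖fderiv ℝ h x‖ := by
    rw [← ofReal_integral_norm_eq_lintegral_enorm i1,
      ← ofReal_integral_norm_eq_lintegral_enorm i2,
      show (2 : ENNReal) ^ d = ENNReal.ofReal (2 ^ d) by
        rw [ENNReal.ofReal_pow (by norm_num)]; simp,
      ← ENNReal.ofReal_mul (by positivity), ← ENNReal.ofReal_mul (by positivity)] at hcP
    exact (ENNReal.ofReal_le_ofReal_iff (by positivity)).1 hcP
  have hKP := fun x (hx : x ∈ B) => hF.density_le hm hb hM hβ hx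
  calc ∫ x in B, |Q x - c * P x|
      ≤ ∫ x in B, K * P 0 * |h x - c| := by
        refine setIntegral_mono_on (ContinuousOn.integrableOn_compact hBc (by fun_prop))
          (ContinuousOn.integrableOn_compact hBc (by fun_prop)) hBm fun x hx => ?_
        rw [habs, mul_comm]
        gcongr
        exact (hKP x hx).1
    _ = K * P 0 * ∫ x in B, |h x - c| := integral_const_mul _ _
    _ ≤ K * P 0 * (2 * R * 2 ^ d * ∫ x in B, ‖fderiv ℝ h x‖) := by
        gcongr
        exact mul_nonneg hK0.le (hP 0).le
    _ = K * (2 * R * 2 ^ d) * ∫ x in B, P 0 * ‖fderiv ℝ h x‖ := by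
        rw [integral_const_mul]; ring
    _ ≤ K * (2 * R * 2 ^ d) * ∫ x in B,
          K * β * ((1 + ‖x‖) * (‖gradient F x - gradient G x‖ * Q x)) := by
        refine mul_le_mul_of_nonneg_left ?_ (by positivity)
        refine setIntegral_mono_on ((hfc.norm.const_mul (P 0)).continuousOn.integrableOn_compact hBc)
          (hik.const_mul _).integrableOn hBm fun x hx => ?_
        calc P 0 * ‖fderiv ℝ h x‖ ≤ K * P x * ‖fderiv ℝ h x‖ := by
              gcongr
              exact (hKP x hx).2
          _ = K * β * (1 * (‖gradient F x - gradient G x‖ * Q x)) := by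
              rw [mul_assoc, mul_comm (P x), hgrad]; ring
          _ ≤ _ := by
              have := (hQ x).le
              gcongr
              linarith [norm_nonneg x]
    _ ≤ K * (2 * R * 2 ^ d) * ∫ x,
          K * β * ((1 + ‖x‖) * (‖gradient F x - gradient G x‖ * Q x)) := by
        refine mul_le_mul_of_nonneg_left ?_ (by positivity)
        refine setIntegral_le_integral (hik.const_mul _) (.of_forall fun x => ?_)
        have := (hQ x).le
        have := hβ.le
        simp only [Pi.zero_apply]
        positivity
    _ = _ := by rw [integral_const_mul]; ring

/-- A weighted total variation bound by a weighted `L¹` norm of the gradient difference. -/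
lemma exists_integral_weight_mul_abs_sub_le (d : ℕ) {m b M β : ℝ} (a : ℝ)
    (hm : 0 < m) (hb : 0 < b) (hM : 0 < M) (hβ : 0 < β) :
    ∃ C : ℝ, 0 < C ∧ ∀ F G, IsPotential d m b M F → IsPotential d m b M G →
      ‖gradient F 0‖ = a →
      ∫ x, (2 + ‖x‖ ^ 2) * |gibbsDensity d β G x - gibbsDensity d β F x| ≤
        C * ∫ x, (1 + ‖x‖) * (‖gradient F x - gradient G x‖ * gibbsDensity d β G x) := by
  obtain ⟨D, hD⟩ : ∃ D, D = β * b + d := ⟨_, rfl⟩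
  have hD0 : 0 < D := by rw [hD]; positivity
  obtain ⟨R, hRdef⟩ : ∃ R, R = 1 + 2 * D / (β * m) := ⟨_, rfl⟩
  have hR1 : 1 ≤ R := by
    have : 0 ≤ 2 * D / (β * m) := by positivity
    linarith
  have hR : 0 < R := by linarith
  obtain ⟨L, hL⟩ : ∃ L, L = exp (β * ((a + M * R) * R)) ^ 2 * (2 * R * 2 ^ d) * β := ⟨_, rfl⟩
  have hL0 : 0 < L := by rw [hL]; positivity
  refine ⟨(2 * L + 3 * (2 / (β * m) * (D * L + β))) * (3 + D / (β * m)), by positivity, ?_⟩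
  intro F G hF hG ha
  obtain ⟨c, hc⟩ := hF.exists_setIntegral_abs_sub_le hG hm hb hM hβ hR
  rw [ha, ← hL] at hc
  have hlyap := hF.integral_norm_sq_mul_abs_sub_le hG hm hb hM hβ c
  have hmom := hF.integral_norm_sq_mul_density_le hm hb hM hβ
  rw [← hD] at hlyap hmom
  set T := ∫ x, (1 + ‖x‖) * (‖gradient F x - gradient G x‖ * gibbsDensity d β G x) with hT
  set P := gibbsDensity d β F with hPdef
  set Q := gibbsDensity d β G with hQdef
  have hP : ∀ x, 0 < P x := hF.density_pos hm hb hβ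
  have hQ : ∀ x, 0 < Q x := hG.density_pos hm hb hβ
  have hPi : Integrable P := hF.integrable_density hm hb hβ
  have hQi : Integrable Q := hG.integrable_density hm hb hβ
  have hP1 : ∫ x, P x = 1 := hF.integral_density hm hb hβ
  have hQ1 : ∫ x, Q x = 1 := hG.integral_density hm hb hβ
  have hPc : Continuous P := (hF.contDiff_density (β := β)).continuous
  have hT0 : 0 ≤ T := integral_nonneg fun x => by
    have := (hQ x).le
    simp only [Pi.zero_apply]
    positivity
  have hi0 : ∀ c, Integrable fun x => |Q x - c * P x| := fun c => by
    simpa using hF.integrable_norm_pow_mul_abs_sub hG hm hb hβ c (n := 0) (by norm_num)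
  have hi2 : ∀ c, Integrable fun x => ‖x‖ ^ 2 * |Q x - c * P x| := fun c =>
    hF.integrable_norm_pow_mul_abs_sub hG hm hb hβ c le_rfl
  have hw : Integrable fun x => (2 + ‖x‖ ^ 2) * |Q x - P x| := by
    refine (((hi0 1).const_mul 2).add (hi2 1)).congr (.of_forall fun x => ?_)
    simp only [Pi.add_apply, one_mul]
    ring
  have hP2 : Integrable fun x => ‖x‖ ^ 2 * P x := by
    refine (hF.integrable_weight hm hb hβ).mono' (Continuous.aestronglyMeasurable (by fun_prop))
      (.of_forall fun x => ?_)
    rw [norm_of_nonneg (mul_nonneg (sq_nonneg _) (hP x).le)]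
    refine mul_le_mul_of_nonneg_right ?_ (hP x).le
    gcongr
    linarith [norm_nonneg x]
  exact (integral_weight_mul_abs_sub_le hP hPi hQi hP1 hQ1 (hi0 c) (hi2 c) hw hP2).trans
    (weighted_bound_of_lyapunov (by positivity) hβ hD0.le hL0.le hT0
      (integral_nonneg fun x => mul_nonneg (sq_nonneg _) (hP x).le) hc hlyap hmom
      (mul_integral_abs_le hR1 hR1 (hi0 c) (hi2 c))
      (mul_integral_abs_le hR1 (by linarith) (hi0 c) (hi2 c)))

/-- The Cauchy–Schwarz step. -/
lemma integral_weight_norm_gradient_sub_le (hF : IsPotential d m b M F)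
    (hG : IsPotential d m b M G) (hm : 0 < m) (hb : 0 < b) (hM : 0 < M) (hβ : 0 < β) :
    ∫ x, (1 + ‖x‖) * (‖gradient F x - gradient G x‖ * gibbsDensity d β G x) ≤
      √(2 + 2 * ((β * b + d) / (β * m))) *
        √(∫ x, ‖gradient F x - gradient G x‖ ^ 2 ∂(gibbs d β G)) := by
  have hmom := hG.integral_norm_sq_mul_density_le hm hb hM hβ
  have hFc := hF.smooth.continuous_gradient
  have hGc := hG.smooth.continuous_gradient
  have hgibbs : ∫ x, ‖gradient F x - gradient G x‖ ^ 2 ∂(gibbs d β G) =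
      ∫ x, ‖gradient F x - gradient G x‖ ^ 2 * gibbsDensity d β G x := by
    have hQc : Continuous (gibbsDensity d β G) := (hG.contDiff_density (β := β)).continuous
    have : gibbs d β G = volume.withDensity fun x => ENNReal.ofReal (gibbsDensity d β G x) := rfl
    rw [this, integral_withDensity_eq_integral_toReal_smul (by fun_prop)
      (.of_forall fun x => ENNReal.ofReal_lt_top)]
    refine integral_congr_ae (.of_forall fun x => ?_)
    simp only [ENNReal.toReal_ofReal (hG.density_pos hm hb hβ x).le, smul_eq_mul]
    ring
  rw [hgibbs]
  set Q := gibbsDensity d β G with hQdef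
  have hQ : ∀ x, 0 < Q x := hG.density_pos hm hb hβ
  have hQi : Integrable Q := hG.integrable_density hm hb hβ
  have hQ1 : ∫ x, Q x = 1 := hG.integral_density hm hb hβ
  have hQc : Continuous Q := (hG.contDiff_density (β := β)).continuous
  have hQ2 := hG.integrable_weight hm hb hβ
  rw [← hQdef] at hQ2
  have sq1 : ∀ x, ((1 + ‖x‖) * √(Q x)) ^ 2 = (1 + ‖x‖) ^ 2 * Q x := fun x => by
    rw [mul_pow, sq_sqrt (hQ x).le]
  have sq2 : ∀ x, (‖gradient F x - gradient G x‖ * √(Q x)) ^ 2 =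
      ‖gradient F x - gradient G x‖ ^ 2 * Q x := fun x => by
    rw [mul_pow, sq_sqrt (hQ x).le]
  have hk2 : Integrable fun x => ‖gradient F x - gradient G x‖ ^ 2 * Q x := by
    refine (hQ2.const_mul ((‖gradient F 0‖ + ‖gradient G 0‖ + 2 * M) ^ 2)).mono'
      (Continuous.aestronglyMeasurable (by fun_prop)) (.of_forall fun x => ?_)
    rw [norm_of_nonneg (mul_nonneg (sq_nonneg _) (hQ x).le), ← mul_assoc, ← mul_pow]
    have h1 : ‖gradient F x - gradient G x‖ ≤
        (‖gradient F 0‖ + ‖gradient G 0‖ + 2 * M) * (1 + ‖x‖) := by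
      have h2 := norm_sub_le (gradient F x) (gradient G x)
      have h3 := hF.smooth.norm_gradient_le x
      have h4 := hG.smooth.norm_gradient_le x
      nlinarith [mul_nonneg (norm_nonneg (gradient F 0)) (norm_nonneg x),
        mul_nonneg (norm_nonneg (gradient G 0)) (norm_nonneg x)]
    exact mul_le_mul_of_nonneg_right (by gcongr) (hQ x).le
  have m1 : MemLp (fun x => (1 + ‖x‖) * √(Q x)) (ENNReal.ofReal 2) := by
    rw [ENNReal.ofReal_ofNat,
      memLp_two_iff_integrable_sq (Continuous.aestronglyMeasurable (by fun_prop))]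
    simpa only [sq1] using hQ2
  have m2 : MemLp (fun x => ‖gradient F x - gradient G x‖ * √(Q x)) (ENNReal.ofReal 2) := by
    rw [ENNReal.ofReal_ofNat,
      memLp_two_iff_integrable_sq (Continuous.aestronglyMeasurable (by fun_prop))]
    simpa only [sq2] using hk2
  have hCS := integral_mul_le_Lp_mul_Lq_of_nonneg Real.HolderConjugate.two_two
    (.of_forall fun x => by positivity) (.of_forall fun x => by positivity) m1 m2
  simp only [rpow_two, sq1, sq2, ← sqrt_eq_rpow] at hCS
  have hl : ∀ x, (1 + ‖x‖) * √(Q x) * (‖gradient F x - gradient G x‖ * √(Q x)) =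
      (1 + ‖x‖) * (‖gradient F x - gradient G x‖ * Q x) := fun x => by
    nth_rewrite 3 [← mul_self_sqrt (hQ x).le]
    ring
  simp only [hl] at hCS
  refine hCS.trans ?_
  gcongr
  have hQn2 : Integrable fun x => ‖x‖ ^ 2 * Q x := by
    refine hQ2.mono' (Continuous.aestronglyMeasurable (by fun_prop)) (.of_forall fun x => ?_)
    rw [norm_of_nonneg (mul_nonneg (sq_nonneg _) (hQ x).le)]
    refine mul_le_mul_of_nonneg_right ?_ (hQ x).le
    gcongr
    linarith [norm_nonneg x]
  calc ∫ x, (1 + ‖x‖) ^ 2 * Q x ≤ ∫ x, (2 * Q x + 2 * (‖x‖ ^ 2 * Q x)) := by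
        refine integral_mono hQ2 ((hQi.const_mul 2).add (hQn2.const_mul 2)) fun x => ?_
        simp only
        nlinarith [mul_nonneg (sq_nonneg (1 - ‖x‖)) (hQ x).le]
    _ = 2 + 2 * ∫ x, ‖x‖ ^ 2 * Q x := by
        rw [integral_add (hQi.const_mul 2) (hQn2.const_mul 2), integral_const_mul,
          integral_const_mul, hQ1, mul_one]
    _ ≤ _ := by gcongr

end IsPotential

/-- The coupling which keeps the common part `η` fixed and transports the remainders
independently. -/
lemma exists_coupling_lintegral_le {α : Type*} [MeasurableSpace α] (η a b : Measure α)
    [IsFiniteMeasure a] [IsFiniteMeasure b] [IsFiniteMeasure η]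
    (hab : a Set.univ = b Set.univ) (h1 : (η + a) Set.univ = 1) :
    ∃ γ : Measure (α × α), IsProbabilityMeasure γ ∧ γ.map Prod.fst = η + a ∧
      γ.map Prod.snd = η + b ∧ ∀ (c : α × α → ENNReal) (v : α → ENNReal), Measurable v →
        (∀ x, c (x, x) = 0) → (∀ x y, c (x, y) ≤ v x + v y) →
        ∫⁻ p, c p ∂γ ≤ (∫⁻ x, v x ∂a) + ∫⁻ x, v x ∂b := by
  set τ := a Set.univ with hτ
  have hτt : τ ≠ ⊤ := measure_ne_top _ _
  have hcancel : ∀ μ : Measure α, μ Set.univ = τ → (τ⁻¹ * τ) • μ = μ := by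
    intro μ hμ
    by_cases h : τ = 0
    · rw [h, Measure.measure_univ_eq_zero] at hμ
      simp [hμ]
    · rw [ENNReal.inv_mul_cancel h hτt, one_smul]
  have hdiag : Measurable fun x : α => (x, x) := by fun_prop
  have hfst : (η.map (fun x => (x, x)) + τ⁻¹ • a.prod b).map Prod.fst = η + a := by
    rw [Measure.map_add _ _ measurable_fst, Measure.map_map measurable_fst hdiag,
      Measure.map_smul, Measure.map_fst_prod, ← hab, smul_smul, hcancel a rfl]
    congr 1
    exact Measure.map_id
  have hsnd : (η.map (fun x => (x, x)) + τ⁻¹ • a.prod b).map Prod.snd = η + b := by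
    rw [Measure.map_add _ _ measurable_snd, Measure.map_map measurable_snd hdiag,
      Measure.map_smul, Measure.map_snd_prod, ← hτ, smul_smul, hcancel b hab.symm]
    congr 1
    exact Measure.map_id
  refine ⟨η.map (fun x => (x, x)) + τ⁻¹ • a.prod b, ⟨?_⟩, hfst, hsnd, ?_⟩
  · rw [← h1, ← hfst, Measure.map_apply measurable_fst MeasurableSet.univ, Set.preimage_univ]
  · intro c v hv hc0 hcv
    have hpa : τ⁻¹ * ∫⁻ p : α × α, v p.1 ∂(a.prod b) = ∫⁻ x, v x ∂a := by
      rw [← lintegral_map hv measurable_fst, Measure.map_fst_prod, ← smul_eq_mul,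
        ← lintegral_smul_measure, smul_smul, ← hab, hcancel a rfl]
    have hpb : τ⁻¹ * ∫⁻ p : α × α, v p.2 ∂(a.prod b) = ∫⁻ x, v x ∂b := by
      rw [← lintegral_map hv measurable_snd, Measure.map_snd_prod, ← smul_eq_mul,
        ← lintegral_smul_measure, smul_smul, ← hτ, hcancel b hab.symm]
    rw [lintegral_add_measure, lintegral_smul_measure, ← hpa, ← hpb, smul_eq_mul, ← mul_add,
      ← lintegral_add_left (f := fun p : α × α => v p.1) (hv.comp measurable_fst)]
    have hz : ∫⁻ p, c p ∂(η.map fun x => (x, x)) = 0 := by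
      refine le_antisymm ((lintegral_map_le _ _).trans ?_) (zero_le)
      simp [hc0]
    rw [hz, zero_add]
    gcongr with p
    exact hcv p.1 p.2

lemma exists_abs_ffun_le (d : ℕ) (m b M β : ℝ) :
    ∃ A : ℝ, 0 < A ∧ ∀ r, 0 ≤ r → |ffun d m b M β r| ≤ A := by
  have hφ : Continuous (phi d m b M β) := by
    unfold phi
    fun_prop
  have hΦ : Continuous (Phi d m b M β) :=
    intervalIntegral.continuous_primitive (fun _ _ => hφ.intervalIntegrable _ _) 0
  have hφ0 : ∀ s, phi d m b M β s ≠ 0 := fun s => (exp_pos _).ne'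
  have hq : Continuous fun s => Phi d m b M β s * (phi d m b M β s)⁻¹ := hΦ.mul (hφ.inv₀ hφ0)
  have hprim : Continuous fun r => ∫ s in (0:ℝ)..r, Phi d m b M β s * (phi d m b M β s)⁻¹ :=
    intervalIntegral.continuous_primitive (fun _ _ => hq.intervalIntegrable _ _) 0
  have hg : Continuous (gfun d m b M β) := by
    have h1 : ∀ R : ℝ, Continuous fun r =>
        ∫ s in (0:ℝ)..(min r R), Phi d m b M β s * (phi d m b M β s)⁻¹ := fun R =>
      hprim.comp (continuous_id.min continuous_const)
    exact (continuous_const.sub (continuous_const.mul (h1 _))).sub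
      (continuous_const.mul (h1 _))
  have hf : Continuous fun r => ∫ s in (0:ℝ)..r, phi d m b M β s * gfun d m b M β s :=
    intervalIntegral.continuous_primitive (fun _ _ => (hφ.mul hg).intervalIntegrable _ _) 0
  obtain ⟨A, hA⟩ := (isCompact_Icc (a := (0:ℝ)) (b := R2 d m b β)).exists_bound_of_continuousOn
    hf.continuousOn
  refine ⟨max A 1, by positivity, fun r hr => ?_⟩
  rw [ffun, if_neg hr.not_gt]
  exact (hA _ ⟨le_min hr Metric.diam_nonneg, min_le_right _ _⟩).trans (le_max_left _ _)

lemma rho2_self (d : ℕ) (m b M β : ℝ) (x : EuclideanSpace ℝ (Fin d)) :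
    rho2 d m b M β x x = 0 := by
  have : min 0 (R2 d m b β) = 0 := min_eq_left Metric.diam_nonneg
  simp [rho2, ffun, this]

lemma exists_abs_rho2_le (d : ℕ) (m b M β : ℝ) :
    ∃ A : ℝ, 0 < A ∧ ∀ x y, |rho2 d m b M β x y| ≤
      A * (2 + ‖x‖ ^ 2) + A * (2 + ‖y‖ ^ 2) := by
  obtain ⟨A, hA, hf⟩ := exists_abs_ffun_le d m b M β
  refine ⟨A * (1 + |kappa d m b M β|), by positivity, fun x y => ?_⟩
  rw [rho2, abs_mul, ← mul_add, mul_assoc]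
  have hU : |Ufun d m b M β x y| ≤
      (1 + |kappa d m b M β|) * ((2 + ‖x‖ ^ 2) + (2 + ‖y‖ ^ 2)) := by
    have h1 : Ufun d m b M β x y =
        1 + kappa d m b M β * (2 + ‖x‖ ^ 2 + ‖y‖ ^ 2) := by
      simp only [Ufun, Vbar]
      ring
    rw [h1]
    refine (abs_add_le _ _).trans ?_
    rw [abs_one, abs_mul, abs_of_nonneg (by positivity : 0 ≤ 2 + ‖x‖ ^ 2 + ‖y‖ ^ 2)]
    nlinarith [abs_nonneg (kappa d m b M β), sq_nonneg ‖x‖, sq_nonneg ‖y‖]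
  exact mul_le_mul (hf _ (norm_nonneg _)) hU (abs_nonneg _) hA.le

/-- The transport cost is bounded by the weighted total variation distance. -/
lemma exists_Wrho2_gibbs_le (d : ℕ) {m b M β : ℝ} (hm : 0 < m) (hb : 0 < b) (hβ : 0 < β) :
    ∃ A : ℝ, 0 < A ∧ ∀ F G, IsPotential d m b M F → IsPotential d m b M G →
      Wrho2 d m b M β (gibbs d β F) (gibbs d β G) ≤
        A * ∫ x, (2 + ‖x‖ ^ 2) * |gibbsDensity d β G x - gibbsDensity d β F x| := by
  obtain ⟨A, hA, hρ⟩ := exists_abs_rho2_le d m b M β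
  refine ⟨A, hA, fun F G hF hG => ?_⟩
  have hi := (hF.integrable_norm_pow_mul_abs_sub hG hm hb hβ 1 (n := 0) (by norm_num)).const_mul 2
    |>.add (hF.integrable_norm_pow_mul_abs_sub hG hm hb hβ 1 le_rfl)
  have hgF : gibbs d β F = volume.withDensity fun x => ENNReal.ofReal (gibbsDensity d β F x) := rfl
  have hgG : gibbs d β G = volume.withDensity fun x => ENNReal.ofReal (gibbsDensity d β G x) := rfl
  set P := gibbsDensity d β F with hPdef
  set Q := gibbsDensity d β G with hQdef
  have hP : ∀ x, 0 < P x := hF.density_pos hm hb hβ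
  have hQ : ∀ x, 0 < Q x := hG.density_pos hm hb hβ
  have hPi : Integrable P := hF.integrable_density hm hb hβ
  have hQi : Integrable Q := hG.integrable_density hm hb hβ
  have hP1 : ∫ x, P x = 1 := hF.integral_density hm hb hβ
  have hQ1 : ∫ x, Q x = 1 := hG.integral_density hm hb hβ
  have hPc : Continuous P := (hF.contDiff_density (β := β)).continuous
  have hQc : Continuous Q := (hG.contDiff_density (β := β)).continuous
  have hint : Integrable fun x => (2 + ‖x‖ ^ 2) * |Q x - P x| := by
    refine hi.congr (.of_forall fun x => ?_)
    simp only [Pi.add_apply, one_mul, pow_zero]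
    ring
  set I := ∫ x, (2 + ‖x‖ ^ 2) * |Q x - P x| with hI
  have hI0 : 0 ≤ I := integral_nonneg fun x => by
    simp only [Pi.zero_apply]
    positivity
  set η : Measure (EuclideanSpace ℝ (Fin d)) :=
    volume.withDensity fun x => ENNReal.ofReal (min (P x) (Q x)) with hη
  set a : Measure (EuclideanSpace ℝ (Fin d)) :=
    volume.withDensity fun x => ENNReal.ofReal (P x - Q x) with ha
  set e : Measure (EuclideanSpace ℝ (Fin d)) :=
    volume.withDensity fun x => ENNReal.ofReal (Q x - P x) with he
  have : IsFiniteMeasure η := isFiniteMeasure_withDensity_ofReal (hPi.inf hQi).2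
  have : IsFiniteMeasure a := isFiniteMeasure_withDensity_ofReal (hPi.sub hQi).2
  have : IsFiniteMeasure e := isFiniteMeasure_withDensity_ofReal (hQi.sub hPi).2
  have hsplit : ∀ p q : ℝ, 0 < p → 0 < q →
      ENNReal.ofReal (min p q) + ENNReal.ofReal (p - q) = ENNReal.ofReal p := by
    intro p q hp hq
    rcases le_total p q with h | h
    · rw [min_eq_left h, ENNReal.ofReal_of_nonpos (sub_nonpos.2 h), add_zero]
    · rw [min_eq_right h, ← ENNReal.ofReal_add hq.le (sub_nonneg.2 h), add_sub_cancel]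
  have hFe : η + a = gibbs d β F := by
    rw [hgF, hη, ha, ← withDensity_add_left (by fun_prop)]
    congr 1
    ext x
    exact hsplit _ _ (hP x) (hQ x)
  have hGe : η + e = gibbs d β G := by
    rw [hgG, hη, he, ← withDensity_add_left (by fun_prop)]
    congr 1
    ext x
    simp only [Pi.add_apply, min_comm (P x)]
    exact hsplit _ _ (hQ x) (hP x)
  have hF1 : gibbs d β F Set.univ = 1 := by
    rw [hgF, withDensity_apply _ MeasurableSet.univ, Measure.restrict_univ,
      ← ofReal_integral_eq_lintegral_ofReal hPi (.of_forall fun x => (hP x).le), hP1,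
      ENNReal.ofReal_one]
  have hG1 : gibbs d β G Set.univ = 1 := by
    rw [hgG, withDensity_apply _ MeasurableSet.univ, Measure.restrict_univ,
      ← ofReal_integral_eq_lintegral_ofReal hQi (.of_forall fun x => (hQ x).le), hQ1,
      ENNReal.ofReal_one]
  have hae : a Set.univ = e Set.univ := by
    have h1 : η Set.univ + a Set.univ = η Set.univ + e Set.univ := by
      rw [← Measure.add_apply, ← Measure.add_apply, hFe, hGe, hF1, hG1]
    exact (ENNReal.add_right_inj (measure_ne_top _ _)).1 h1
  obtain ⟨γ, hγ, hγ1, hγ2, hγc⟩ := exists_coupling_lintegral_le η a e hae (by rw [hFe, hF1])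
  rw [hFe] at hγ1
  rw [hGe] at hγ2
  have hv : Measurable fun x : EuclideanSpace ℝ (Fin d) =>
      ENNReal.ofReal (A * (2 + ‖x‖ ^ 2)) := by fun_prop
  have hcost := hγc (fun p => ‖rho2 d m b M β p.1 p.2‖ₑ)
    (fun x => ENNReal.ofReal (A * (2 + ‖x‖ ^ 2))) hv (fun x => by simp [rho2_self])
    (fun x y => by
      rw [← ofReal_norm, ← ENNReal.ofReal_add (by positivity) (by positivity)]
      exact ENNReal.ofReal_le_ofReal (hρ x y))
  have htv : (∫⁻ x, ENNReal.ofReal (A * (2 + ‖x‖ ^ 2)) ∂a) +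
      ∫⁻ x, ENNReal.ofReal (A * (2 + ‖x‖ ^ 2)) ∂e = ENNReal.ofReal (A * I) := by
    rw [ha, he, lintegral_withDensity_eq_lintegral_mul _ (by fun_prop) hv,
      lintegral_withDensity_eq_lintegral_mul _ (by fun_prop) hv,
      ← lintegral_add_left (by fun_prop), hI, ← integral_const_mul,
      ofReal_integral_eq_lintegral_ofReal (hint.const_mul A)
        (.of_forall fun x => by simp only [Pi.zero_apply]; positivity)]
    refine lintegral_congr fun x => ?_
    simp only [Pi.mul_apply]
    rw [← add_mul, ← mul_assoc, mul_comm,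
      ENNReal.ofReal_mul (p := A * (2 + ‖x‖ ^ 2)) (q := |Q x - P x|) (by positivity)]
    congr 1
    rcases le_total (P x) (Q x) with h | h
    · rw [ENNReal.ofReal_of_nonpos (sub_nonpos.2 h), zero_add, abs_of_nonneg (sub_nonneg.2 h)]
    · rw [ENNReal.ofReal_of_nonpos (sub_nonpos.2 h), add_zero, abs_of_nonpos (sub_nonpos.2 h),
        neg_sub]
  rw [htv] at hcost
  have hle : ∫ p, rho2 d m b M β p.1 p.2 ∂γ ≤ A * I := by
    refine (le_abs_self _).trans ?_
    rw [← ENNReal.ofReal_le_ofReal_iff (by positivity), ← norm_eq_abs, ofReal_norm]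
    exact (enorm_integral_le_lintegral_enorm _).trans hcost
  rw [Wrho2]
  by_cases hbdd : BddBelow (Set.range fun γ : {γ : Measure (EuclideanSpace ℝ (Fin d) ×
      EuclideanSpace ℝ (Fin d)) // IsProbabilityMeasure γ ∧ γ.map Prod.fst = gibbs d β F ∧
        γ.map Prod.snd = gibbs d β G} => ∫ p, rho2 d m b M β p.1 p.2 ∂γ.1)
  · exact (ciInf_le hbdd ⟨γ, hγ, hγ1, hγ2⟩).trans hle
  · rw [iInf, Real.sInf_of_not_bddBelow hbdd]
    positivity

theorem stmt1 (d : ℕ) (hd : 1 ≤ d) (m b M β : ℝ)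
    (hm : 0 < m) (hb : 0 < b) (hM : 0 < M) (hβ : 0 < β)
    (aF aG : ℝ) :
    ∃ C₀ : ℝ, 0 < C₀ ∧
      ∀ F G : EuclideanSpace ℝ (Fin d) → ℝ,
        ContDiff ℝ 1 F → ContDiff ℝ 1 G →
        (∀ x, 0 ≤ F x) → (∀ x, 0 ≤ G x) →
        Dissipative d m b F → Dissipative d m b G →
        LSmooth d M F → LSmooth d M G →
        ‖gradient F 0‖ = aF → ‖gradient G 0‖ = aG →
        Wrho2 d m b M β (gibbs d β F) (gibbs d β G) ≤
          C₀ * Real.sqrt (∫ x, ‖gradient F x - gradient G x‖ ^ 2 ∂(gibbs d β G)) := by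
  obtain ⟨A, hA, hW⟩ := exists_Wrho2_gibbs_le d (M := M) hm hb hβ
  obtain ⟨C, hC, hTV⟩ :=
    IsPotential.exists_integral_weight_mul_abs_sub_le d aF hm hb hM hβ
  refine ⟨A * (C * √(2 + 2 * ((β * b + d) / (β * m)))), by positivity, ?_⟩
  intro F G hF hG hF0 hG0 hFd hGd hFs hGs haF _
  have pF : IsPotential d m b M F := ⟨hF, hF0, hFd, hFs⟩
  have pG : IsPotential d m b M G := ⟨hG, hG0, hGd, hGs⟩
  calc Wrho2 d m b M β (gibbs d β F) (gibbs d β G)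
      ≤ A * ∫ x, (2 + ‖x‖ ^ 2) * |gibbsDensity d β G x - gibbsDensity d β F x| := hW F G pF pG
    _ ≤ A * (C * ∫ x, (1 + ‖x‖) *
          (‖gradient F x - gradient G x‖ * gibbsDensity d β G x)) := by
        gcongr
        exact hTV F G pF pG haF
    _ ≤ A * (C * (√(2 + 2 * ((β * b + d) / (β * m))) *
          √(∫ x, ‖gradient F x - gradient G x‖ ^ 2 ∂(gibbs d β G)))) := by
        gcongr
        exact pF.integral_weight_norm_gradient_sub_le pG hm hb hM hβ
    _ = _ := by ring

end
end

section
/- Let d ≥ 1 be an integer and m, b, M, β > 0, and let A > 0. Then for all x, y ∈ ℝ^d, ((M/2)‖x‖ + (M/2)‖y‖ + A)‖x − y‖ ≤ 2 exp(MβR₂²/8 + 2R₂) · max{1, 1/R₂} · max{A + M/2, (1/κ)(A/2 + M)} · ρ₂(x, y). -/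
open MeasureTheory Real RealInnerProductSpace

noncomputable section

lemma diam_sublevel_pos {d : ℕ} (hd : 1 ≤ d) {K : ℝ} (hK : 2 < K) :
    0 < Metric.diam {p : EuclideanSpace ℝ (Fin d) × EuclideanSpace ℝ (Fin d) |
      Vbar p.1 + Vbar p.2 ≤ K} := by
  have hbdd : Bornology.IsBounded {p : EuclideanSpace ℝ (Fin d) × EuclideanSpace ℝ (Fin d) |
      Vbar p.1 + Vbar p.2 ≤ K} := by
    refine (Metric.isBounded_closedBall (x := 0) (r := K)).subset fun p hp => ?_
    simp only [Set.mem_ofPred_eq, Vbar] at hp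
    rw [mem_closedBall_zero_iff, Prod.norm_def]
    exact max_le (by nlinarith [sq_nonneg (‖p.1‖ - 1), sq_nonneg ‖p.2‖])
      (by nlinarith [sq_nonneg (‖p.2‖ - 1), sq_nonneg ‖p.1‖])
  let v : EuclideanSpace ℝ (Fin d) := EuclideanSpace.single ⟨0, hd⟩ (√(K - 2))
  have hpos : 0 < √(K - 2) := Real.sqrt_pos.2 (by linarith)
  have hv : ‖v‖ = √(K - 2) := by
    simp [v, abs_of_pos hpos]
  have hv0 : 0 < dist (v, (0 : EuclideanSpace ℝ (Fin d))) 0 :=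
    dist_pos.2 fun h => by
      have : v = 0 := congrArg Prod.fst h
      rw [this, norm_zero] at hv
      exact hpos.ne hv
  refine hv0.trans_le (Metric.dist_le_diam_of_mem hbdd ?_ ?_)
  · simp only [Set.mem_ofPred_eq, Vbar, hv, norm_zero]
    rw [Real.sq_sqrt (by linarith)]
    linarith
  · simp only [Set.mem_ofPred_eq, Vbar, Prod.fst_zero, Prod.snd_zero, norm_zero]
    linarith

lemma Cc_gt (d : ℕ) {m b β : ℝ} (hb : 0 < b) (hβ : 0 < β) : m < Cc d m b β := by
  have : 0 ≤ (d : ℝ) / β := by positivity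
  unfold Cc
  linarith

lemma R1_pos {d : ℕ} (hd : 1 ≤ d) {m b β : ℝ} (hm : 0 < m) (hb : 0 < b) (hβ : 0 < β) :
    0 < R1 d m b β := by
  refine diam_sublevel_pos hd ?_
  rw [lt_div_iff₀ hm]
  linarith [Cc_gt d (m := m) hb hβ]

lemma R2_pos {d : ℕ} (hd : 1 ≤ d) {m b β : ℝ} (hm : 0 < m) (hb : 0 < b) (hβ : 0 < β) :
    0 < R2 d m b β := by
  refine diam_sublevel_pos hd ?_
  have h := Cc_gt d (m := m) hb hβ
  have : m * (1 + 1 / m) ≤ Cc d m b β * (1 + 1 / m) := by gcongr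
  have h1 : m * (1 + 1 / m) = m + 1 := by field_simp
  nlinarith

lemma kappa_pos {d : ℕ} (hd : 1 ≤ d) {m b M β : ℝ} (hm : 0 < m) (hb : 0 < b) (hβ : 0 < β) :
    0 < kappa d m b M β := by
  have hC := hm.trans (Cc_gt d (m := m) hb hβ)
  have hR := R1_pos hd hm hb hβ
  have hexp : 0 < Real.exp (2 * R1 d m b β) - 1 - 2 * R1 d m b β := by
    linarith [Real.add_one_lt_exp (x := 2 * R1 d m b β) (by positivity)]
  exact lt_min (by norm_num) (by positivity)

lemma Qk_le_one (d : ℕ) (m b M β : ℝ) : Qk d m b M β ≤ 1 := by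
  have : √(kappa d m b M β - kappa d m b M β ^ 2) ≤ 1 / 2 := by
    refine Real.sqrt_le_iff.2 ⟨by norm_num, ?_⟩
    nlinarith [sq_nonneg (kappa d m b M β - 1 / 2)]
  unfold Qk
  linarith

lemma phi_pos (d : ℕ) (m b M β r : ℝ) : 0 < phi d m b M β r := Real.exp_pos _

lemma continuous_phi (d : ℕ) (m b M β : ℝ) : Continuous (phi d m b M β) := by
  unfold phi
  fun_prop

lemma Phi_nonneg (d : ℕ) (m b M β : ℝ) {r : ℝ} (hr : 0 ≤ r) : 0 ≤ Phi d m b M β r :=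
  intervalIntegral.integral_nonneg hr fun s _ => (phi_pos d m b M β s).le

lemma continuous_Phi_mul_inv_phi (d : ℕ) (m b M β : ℝ) :
    Continuous fun s => Phi d m b M β s * (phi d m b M β s)⁻¹ := by
  refine Continuous.mul ?_ ((continuous_phi d m b M β).inv₀ fun s => (phi_pos d m b M β s).ne')
  exact intervalIntegral.continuous_primitive
    (fun a c => (continuous_phi d m b M β).intervalIntegrable a c) 0

lemma continuous_gfun (d : ℕ) (m b M β : ℝ) : Continuous (gfun d m b M β) := by
  have h : Continuous fun r => ∫ s in (0:ℝ)..r, Phi d m b M β s * (phi d m b M β s)⁻¹ :=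
    intervalIntegral.continuous_primitive
      (fun a c => (continuous_Phi_mul_inv_phi d m b M β).intervalIntegrable a c) 0
  have hmin (R : ℝ) := h.comp (continuous_id.min (continuous_const (y := R)))
  exact (continuous_const.sub (continuous_const.mul (hmin _))).sub
    (continuous_const.mul (hmin _))

lemma inv_integral_mul_integral_min_le_one (d : ℕ) (m b M β : ℝ) {r R : ℝ}
    (hr : 0 ≤ r) (hR : 0 ≤ R) :
    (∫ s in (0:ℝ)..R, Phi d m b M β s * (phi d m b M β s)⁻¹)⁻¹ *
      (∫ s in (0:ℝ)..(min r R), Phi d m b M β s * (phi d m b M β s)⁻¹) ≤ 1 := by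
  have hnonneg {s : ℝ} (hs : 0 ≤ s) : 0 ≤ Phi d m b M β s * (phi d m b M β s)⁻¹ :=
    mul_nonneg (Phi_nonneg d m b M β hs) (inv_nonneg.2 (phi_pos d m b M β s).le)
  have hint (a c : ℝ) := (continuous_Phi_mul_inv_phi d m b M β).intervalIntegrable
    (μ := volume) a c
  refine inv_mul_le_one_of_le₀ ?_ (intervalIntegral.integral_nonneg hR fun s hs => hnonneg hs.1)
  rw [← intervalIntegral.integral_add_adjacent_intervals (hint 0 (min r R)) (hint (min r R) R)]
  have := intervalIntegral.integral_nonneg (μ := volume) (min_le_right r R)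
    fun s hs => hnonneg ((le_min hr hR).trans hs.1)
  linarith

lemma half_le_gfun (d : ℕ) (m b M β : ℝ) {r : ℝ} (hr : 0 ≤ r) : 1 / 2 ≤ gfun d m b M β r := by
  have h1 := inv_integral_mul_integral_min_le_one d m b M β hr
    (Metric.diam_nonneg (s := S1 d m b β))
  have h2 := inv_integral_mul_integral_min_le_one d m b M β hr
    (Metric.diam_nonneg (s := S2 d m b β))
  unfold gfun zeta xi R1 R2
  linarith

lemma inv_exp_le_phi (d : ℕ) {m b M β r R : ℝ} (hM : 0 < M) (hβ : 0 < β)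
    (hr : 0 ≤ r) (hrR : r ≤ R) :
    (Real.exp (M * β * R ^ 2 / 8 + 2 * R))⁻¹ ≤ phi d m b M β r := by
  rw [← Real.exp_neg, phi, Real.exp_le_exp]
  have h1 : Qk d m b M β * r ≤ 1 * R :=
    mul_le_mul (Qk_le_one d m b M β) hrR hr zero_le_one
  have h2 : M * β * r ^ 2 ≤ M * β * R ^ 2 := by gcongr
  linarith

lemma min_le_mul_ffun (d : ℕ) {m b M β r : ℝ} (hM : 0 < M) (hβ : 0 < β) (hr : 0 ≤ r) :
    min r (R2 d m b β) ≤
      2 * Real.exp (M * β * R2 d m b β ^ 2 / 8 + 2 * R2 d m b β) * ffun d m b M β r := by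
  set E := Real.exp (M * β * R2 d m b β ^ 2 / 8 + 2 * R2 d m b β) with hE
  have hEpos : 0 < E := Real.exp_pos _
  have hmin : 0 ≤ min r (R2 d m b β) := le_min hr Metric.diam_nonneg
  have key : ∫ _ in (0:ℝ)..(min r (R2 d m b β)), E⁻¹ * (1 / 2) ≤ ffun d m b M β r := by
    rw [ffun, if_neg hr.not_gt]
    refine intervalIntegral.integral_mono_on hmin (by simp)
      (((continuous_phi d m b M β).mul (continuous_gfun d m b M β)).intervalIntegrable _ _)
      fun s hs => ?_
    exact mul_le_mul (inv_exp_le_phi d hM hβ hs.1 (hs.2.trans (min_le_right _ _)))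
      (half_le_gfun d m b M β hs.1) (by norm_num) (phi_pos d m b M β s).le
  rw [intervalIntegral.integral_const, sub_zero, smul_eq_mul] at key
  calc min r (R2 d m b β) = 2 * E * (min r (R2 d m b β) * (E⁻¹ * (1 / 2))) := by
        field_simp
    _ ≤ _ := by gcongr

lemma add_mul_sq_le_max_mul_Ufun {d : ℕ} {m b M β A : ℝ} (hκ : 0 < kappa d m b M β)
    (hM : 0 < M) (hA : 0 < A) (x y : EuclideanSpace ℝ (Fin d)) :
    A + M / 2 + (A / 2 + M) * (‖x‖ ^ 2 + ‖y‖ ^ 2) ≤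
      max (A + M / 2) (1 / kappa d m b M β * (A / 2 + M)) * Ufun d m b M β x y := by
  set κ := kappa d m b M β with hκ_def
  set c := max (A + M / 2) (1 / κ * (A / 2 + M))
  have h1 : A + M / 2 ≤ c := le_max_left _ _
  have h2 : A / 2 + M ≤ c * κ := by
    rw [← div_le_iff₀ hκ]
    exact (le_of_eq (by ring)).trans (le_max_right _ _)
  have h3 : (A / 2 + M) * (‖x‖ ^ 2 + ‖y‖ ^ 2) ≤ c * κ * (‖x‖ ^ 2 + ‖y‖ ^ 2) := by gcongr
  have hU : Ufun d m b M β x y = 1 + 2 * κ + κ * (‖x‖ ^ 2 + ‖y‖ ^ 2) := by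
    simp only [Ufun, Vbar, ← hκ_def]
    ring
  rw [hU]
  linarith

theorem stmt3 (d : ℕ) (hd : 1 ≤ d) (m b M β A : ℝ)
    (hm : 0 < m) (hb : 0 < b) (hM : 0 < M) (hβ : 0 < β) (hA : 0 < A)
    (x y : EuclideanSpace ℝ (Fin d)) :
    (M / 2 * ‖x‖ + M / 2 * ‖y‖ + A) * ‖x - y‖ ≤
      2 * Real.exp (M * β * R2 d m b β ^ 2 / 8 + 2 * R2 d m b β) *
        max 1 (1 / R2 d m b β) *
        max (A + M / 2) (1 / kappa d m b M β * (A / 2 + M)) *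
        rho2 d m b M β x y := by
  have hR := R2_pos hd hm hb hβ
  have hκ := kappa_pos (M := M) hd hm hb hβ
  have hf := min_le_mul_ffun d (m := m) (b := b) hM hβ (norm_nonneg (x - y))
  have hU := add_mul_sq_le_max_mul_Ufun hκ hM hA x y
  have hx := norm_nonneg x
  have hy := norm_nonneg y
  set E := Real.exp (M * β * R2 d m b β ^ 2 / 8 + 2 * R2 d m b β)
  set c := max (A + M / 2) (1 / kappa d m b M β * (A / 2 + M))
  have hcU : 0 ≤ c * Ufun d m b M β x y := le_trans (by positivity) hU
  suffices h : (M / 2 * ‖x‖ + M / 2 * ‖y‖ + A) * ‖x - y‖ ≤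
      (min ‖x - y‖ (R2 d m b β) * max 1 (1 / R2 d m b β)) * (c * Ufun d m b M β x y) by
    calc _ ≤ _ := h
      _ ≤ (2 * E * ffun d m b M β ‖x - y‖ * max 1 (1 / R2 d m b β)) *
          (c * Ufun d m b M β x y) := by gcongr
      _ = _ := by rw [rho2]; ring
  rcases le_total ‖x - y‖ (R2 d m b β) with hle | hle
  · rw [min_eq_left hle, mul_comm]
    have hcoef : M / 2 * ‖x‖ + M / 2 * ‖y‖ + A ≤ c * Ufun d m b M β x y := by
      refine le_trans ?_ hU
      nlinarith [mul_nonneg hM.le (sq_nonneg (‖x‖ - 1)), mul_nonneg hM.le (sq_nonneg (‖y‖ - 1)),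
        mul_nonneg hM.le (sq_nonneg ‖x‖), mul_nonneg hM.le (sq_nonneg ‖y‖),
        mul_nonneg hA.le (sq_nonneg ‖x‖), mul_nonneg hA.le (sq_nonneg ‖y‖)]
    refine mul_le_mul ?_ hcoef (by positivity) (by positivity)
    exact le_mul_of_one_le_right (norm_nonneg _) (le_max_left _ _)
  · rw [min_eq_right hle]
    have hone : 1 ≤ R2 d m b β * max 1 (1 / R2 d m b β) :=
      calc 1 = R2 d m b β * (1 / R2 d m b β) := by field_simp
        _ ≤ _ := by gcongr; exact le_max_right _ _
    refine le_trans ?_ (le_mul_of_one_le_left hcU hone)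
    refine le_trans ?_ hU
    calc _ ≤ (M / 2 * ‖x‖ + M / 2 * ‖y‖ + A) * (‖x‖ + ‖y‖) := by
          gcongr
          exact norm_sub_le x y
      _ ≤ _ := by
          nlinarith [mul_nonneg hM.le (sq_nonneg (‖x‖ - ‖y‖)),
            mul_nonneg hA.le (sq_nonneg (‖x‖ - 1)), mul_nonneg hA.le (sq_nonneg (‖y‖ - 1))]

end
end
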